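/- arXiv:1908.06533 — 2 statements merged into one kernel-verified Lean document; each statement's English description precedes it below -/
import Mathlib

section
/- Let T > 0. Then there exists n₀ ∈ ℕ such that for every even n ≥ n₀ the following holds. Let x* : ℝ → ℝ be a twice differentiable, nonconstant solution of the single-well Duffing equation x*''(t) + x*(t) + x*(t)³ = 0 with minimal period 2T/n (so that x*(t − T) = x*(t) and x* solves the delayed Duffing equation x''(t) + x(t − T) + x(t)³ = 0). Then x* is unstable as a periodic orbit of the delayed Duffing equation; in particular there exists a twice differentiable solution y : ℝ → ℝ of the delayed Duffing equation y''(t) + y(t − T) + y(t)³ = 0 such that y is not a time shift of x* (i.e., there is no θ with y(t) = x*(t + θ) for all t), yet y converges to the orbit of x* in backward time: inf_{θ ∈ ℝ} sup_{s ∈ [t − T, t]} (|y(s) − x*(s + θ)| + |y'(s) − x*'(s + θ)|) → 0 as t → −∞. -/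
open Filter
open scoped NNReal Topology

/-- Coordinatewise truncation of the plane to the square of radius `R`. -/
noncomputable def planeClip (R : ℝ) (x : ℝ × ℝ) : ℝ × ℝ :=
  (max (-R) (min R x.1), max (-R) (min R x.2))

lemma abs_max_min_sub_le (R a b : ℝ) :
    |max (-R) (min R a) - max (-R) (min R b)| ≤ |a - b| := by
  rw [max_comm (-R), max_comm (-R), min_comm R, min_comm R]
  refine (abs_max_sub_max_le_abs _ _ _).trans ?_
  have h := abs_min_sub_min_le_max a R b R
  rwa [sub_self, abs_zero, max_eq_left (abs_nonneg _)] at h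

lemma lipschitzWith_planeClip (R : ℝ) : LipschitzWith 1 (planeClip R) := by
  refine LipschitzWith.of_dist_le_mul fun x y => ?_
  simp only [planeClip, Prod.dist_eq, Real.dist_eq, NNReal.coe_one, one_mul]
  exact max_le_max (abs_max_min_sub_le _ _ _) (abs_max_min_sub_le _ _ _)

lemma norm_planeClip_le_radius {R : ℝ} (hR : 0 ≤ R) (x : ℝ × ℝ) : ‖planeClip R x‖ ≤ R := by
  simp only [planeClip, Prod.norm_def, Real.norm_eq_abs]
  refine max_le (abs_le.2 ⟨le_max_left _ _, ?_⟩) (abs_le.2 ⟨le_max_left _ _, ?_⟩) <;>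
  exact max_le (by linarith) (min_le_left _ _)

lemma norm_planeClip_le {R : ℝ} (hR : 0 ≤ R) (x : ℝ × ℝ) : ‖planeClip R x‖ ≤ ‖x‖ := by
  have h := (lipschitzWith_planeClip R).dist_le_mul x 0
  have h0 : planeClip R 0 = 0 := by simp [planeClip, hR]
  simpa [h0] using h

lemma planeClip_of_norm_le {R : ℝ} {x : ℝ × ℝ} (h : ‖x‖ ≤ R) : planeClip R x = x := by
  have h1 := abs_le.1 ((norm_fst_le x).trans h)
  have h2 := abs_le.1 ((norm_snd_le x).trans h)
  ext <;> simp only [planeClip]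
  · rw [min_eq_right h1.2, max_eq_right h1.1]
  · rw [min_eq_right h2.2, max_eq_right h2.1]

lemma norm_le_gronwallBound_two_sided {u u' : ℝ → ℝ × ℝ} {t₀ N K C : ℝ}
    (hu : ∀ t ∈ Set.Icc (t₀ - N) (t₀ + N), HasDerivAt u (u' t) t)
    (hb : ∀ t ∈ Set.Icc (t₀ - N) (t₀ + N), ‖u' t‖ ≤ K * ‖u t‖ + C)
    (hK : 0 ≤ K) (hC : 0 ≤ C) :
    ∀ t ∈ Set.Icc (t₀ - N) (t₀ + N), ‖u t‖ ≤ gronwallBound ‖u t₀‖ K C N := by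
  have key : ∀ s ∈ Set.Icc 0 N, ∀ e : ℝ, e = 1 ∨ e = -1 →
      ‖u (t₀ + e * s)‖ ≤ gronwallBound ‖u t₀‖ K C N := by
    intro s hs e he
    have hmem : ∀ r ∈ Set.Icc 0 N, t₀ + e * r ∈ Set.Icc (t₀ - N) (t₀ + N) := by
      intro r hr
      rcases he with rfl | rfl <;> constructor <;> linarith [hr.1, hr.2]
    have hd : ∀ r ∈ Set.Icc 0 N,
        HasDerivAt (fun r => u (t₀ + e * r)) (e • u' (t₀ + e * r)) r := by
      intro r hr
      have h1 : HasDerivAt (fun r : ℝ => t₀ + e * r) e r := by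
        simpa using ((hasDerivAt_id r).const_mul e).const_add t₀
      exact (hu _ (hmem r hr)).scomp r h1
    have h := norm_le_gronwallBound_of_norm_deriv_right_le (f := fun r => u (t₀ + e * r))
      (f' := fun r => e • u' (t₀ + e * r)) (δ := ‖u t₀‖) (K := K) (ε := C) (a := 0) (b := N)
      (fun r hr => (hd r hr).continuousAt.continuousWithinAt)
      (fun r hr => (hd r ⟨hr.1, hr.2.le⟩).hasDerivWithinAt) (by simp)
      (fun r hr => by
        have : ‖e‖ = 1 := by rcases he with rfl | rfl <;> simp
        rw [norm_smul, this, one_mul]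
        exact hb _ (hmem r ⟨hr.1, hr.2.le⟩)) s hs
    refine h.trans (gronwallBound_mono (norm_nonneg _) hC hK ?_)
    linarith [hs.2]
  intro t ht
  rcases le_total t₀ t with h | h
  · have := key (t - t₀) ⟨by linarith, by linarith [ht.2]⟩ 1 (Or.inl rfl)
    simpa using this
  · have := key (t₀ - t) ⟨by linarith, by linarith [ht.1]⟩ (-1) (Or.inr rfl)
    simpa using this

lemma exists_hasDerivAt_Ioo_of_lipschitz {f : ℝ → ℝ × ℝ → ℝ × ℝ} {K : ℝ≥0}
    (hL : ∀ t, LipschitzWith K (f t)) (hc : ∀ x, Continuous fun t => f t x)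
    (t₀ : ℝ) (x₀ : ℝ × ℝ) {N : ℝ} (hN : 0 < N) :
    ∃ u : ℝ → ℝ × ℝ, u t₀ = x₀ ∧
      ∀ t ∈ Set.Ioo (t₀ - N) (t₀ + N), HasDerivAt u (f t (u t)) t := by
  obtain ⟨C, hC⟩ := (isCompact_Icc (a := t₀ - (N + 1)) (b := t₀ + (N + 1))).exists_bound_of_continuousOn
    (hc 0).continuousOn
  have hC0 : 0 ≤ C := (norm_nonneg _).trans (hC t₀ ⟨by linarith, by linarith⟩)
  set R := gronwallBound ‖x₀‖ K C N with hR
  have hR0 : 0 ≤ R := by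
    have := gronwallBound_mono (norm_nonneg x₀) hC0 K.2 hN.le
    rw [gronwallBound_x0] at this
    exact (norm_nonneg _).trans this
  have hgrow : ∀ t ∈ Set.Icc (t₀ - (N + 1)) (t₀ + (N + 1)), ∀ x, ‖f t x‖ ≤ K * ‖x‖ + C := by
    intro t ht x
    have h1 := (hL t).dist_le_mul x 0
    rw [dist_eq_norm, dist_zero_right] at h1
    have h2 := norm_le_norm_add_norm_sub (f t 0) (f t x)
    rw [← norm_sub_rev] at h2
    linarith [hC t ht, norm_sub_rev (f t x) (f t 0)]
  have hPL : IsPicardLindelof (fun t x => f t (planeClip R x)) (tmin := t₀ - (N + 1))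
      (tmax := t₀ + (N + 1)) ⟨t₀, by linarith, by linarith⟩ x₀
      (⟨(K * R + C) * (N + 1), by positivity⟩ : ℝ≥0) 0 ⟨K * R + C, by positivity⟩ K := by
    refine ⟨fun t _ => ?_, fun x _ => (hc _).continuousOn, fun t ht x _ => ?_, ?_⟩
    · have := (hL t).comp (lipschitzWith_planeClip R)
      rw [mul_one] at this
      exact this.lipschitzOnWith
    · refine (hgrow t ht _).trans ?_
      change _ ≤ K * R + C
      gcongr
      exact norm_planeClip_le_radius hR0 x
    · change (K * R + C) * _ ≤ (K * R + C) * (N + 1) - 0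
      simp
  obtain ⟨u, hu0, hu⟩ := hPL.exists_eq_forall_mem_Icc_hasDerivWithinAt₀
  have hd : ∀ t ∈ Set.Icc (t₀ - N) (t₀ + N), HasDerivAt u (f t (planeClip R (u t))) t :=
    fun t ht => (hu t ⟨by linarith [ht.1], by linarith [ht.2]⟩).hasDerivAt
      (Icc_mem_nhds (by linarith [ht.1]) (by linarith [ht.2]))
  have hbound := norm_le_gronwallBound_two_sided hd (K := K) (C := C) (fun t ht => by
    refine (hgrow t ⟨by linarith [ht.1], by linarith [ht.2]⟩ _).trans ?_
    gcongr
    exact norm_planeClip_le hR0 _) K.2 hC0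
  have hu0' : u t₀ = x₀ := hu0
  rw [hu0', ← hR] at hbound
  refine ⟨u, hu0, fun t ht => ?_⟩
  have ht' := Set.Ioo_subset_Icc_self ht
  have := hd t ht'
  rwa [planeClip_of_norm_le (hbound t ht')] at this

/-- Global existence for a globally Lipschitz planar vector field. -/
lemma exists_hasDerivAt_of_lipschitz {f : ℝ → ℝ × ℝ → ℝ × ℝ} {K : ℝ≥0}
    (hL : ∀ t, LipschitzWith K (f t)) (hc : ∀ x, Continuous fun t => f t x)
    (t₀ : ℝ) (x₀ : ℝ × ℝ) :
    ∃ u : ℝ → ℝ × ℝ, u t₀ = x₀ ∧ ∀ t, HasDerivAt u (f t (u t)) t := by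
  choose u hu0 hu using fun n : ℕ =>
    exists_hasDerivAt_Ioo_of_lipschitz hL hc t₀ x₀ (N := n + 1) (by positivity)
  have hag : ∀ n m : ℕ, n ≤ m → Set.EqOn (u n) (u m) (Set.Ioo (t₀ - (n + 1)) (t₀ + (n + 1))) := by
    intro n m hnm
    have hnm' : (n : ℝ) ≤ m := by exact_mod_cast hnm
    refine ODE_solution_unique_of_mem_Ioo (v := f) (s := fun _ => Set.univ) (K := K) (t₀ := t₀)
      (fun t _ => (hL t).lipschitzOnWith) ⟨by linarith [n.cast_nonneg (α := ℝ)], by linarith [n.cast_nonneg (α := ℝ)]⟩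
      (fun t ht => ⟨hu n t ht, trivial⟩) (fun t ht => ⟨hu m t ⟨?_, ?_⟩, trivial⟩)
      ((hu0 n).trans (hu0 m).symm)
    · linarith [ht.1]
    · linarith [ht.2]
  refine ⟨fun t => u ⌈|t - t₀|⌉₊ t, hu0 _, fun t => ?_⟩
  have hmem : ∀ s, s ∈ Set.Ioo (t₀ - ((⌈|s - t₀|⌉₊ : ℕ) + 1)) (t₀ + ((⌈|s - t₀|⌉₊ : ℕ) + 1)) := by
    intro s
    have h := abs_le.1 (Nat.le_ceil |s - t₀|)
    constructor <;> linarith [h.1, h.2]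
  set n := ⌈|t - t₀|⌉₊ with hn
  refine (hu n t (hmem t)).congr_of_eventuallyEq ?_
  filter_upwards [isOpen_Ioo.mem_nhds (hmem t)] with s hs
  rcases le_total n ⌈|s - t₀|⌉₊ with h | h
  · exact (hag _ _ h hs).symm
  · exact hag _ _ h (hmem s)

lemma lipschitzWith_second_order {k : ℝ → ℝ} {K : ℝ≥0} (hk : LipschitzWith K k) :
    LipschitzWith (max 1 K) fun x : ℝ × ℝ => (x.2, k x.1) := by
  have h1 : LipschitzWith 1 fun x : ℝ × ℝ => x.2 := LipschitzWith.prod_snd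
  have h2 : LipschitzWith (K * 1) fun x : ℝ × ℝ => k x.1 := hk.comp LipschitzWith.prod_fst
  simpa using h1.prodMk h2

/-- Global existence for scalar second-order equations with globally Lipschitz right-hand side. -/
lemma exists_second_order_of_lipschitz {h : ℝ → ℝ → ℝ} {K : ℝ≥0}
    (hL : ∀ t, LipschitzWith K (h t)) (hc : ∀ y, Continuous fun t => h t y) (t₀ a b : ℝ) :
    ∃ y v : ℝ → ℝ, y t₀ = a ∧ v t₀ = b ∧ ∀ t, HasDerivAt y (v t) t ∧
      HasDerivAt v (h t (y t)) t := by
  obtain ⟨u, hu0, hu⟩ := exists_hasDerivAt_of_lipschitz (f := fun t x => (x.2, h t x.1))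
    (K := max 1 K) (fun t => lipschitzWith_second_order (hL t)) (fun x => by have := hc x.1; fun_prop) t₀ (a, b)
  refine ⟨fun t => (u t).1, fun t => (u t).2, by simp [hu0], by simp [hu0], fun t => ?_⟩
  exact ⟨(hasFDerivAt_fst (𝕜 := ℝ) (p := u t)).comp_hasDerivAt t (hu t),
    (hasFDerivAt_snd (𝕜 := ℝ) (p := u t)).comp_hasDerivAt t (hu t)⟩

/-- Uniqueness for scalar second-order equations with globally Lipschitz right-hand side. -/
lemma second_order_unique {h : ℝ → ℝ → ℝ} {K : ℝ≥0}
    (hL : ∀ t, LipschitzWith K (h t)) {t₀ : ℝ} {y v z w : ℝ → ℝ}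
    (hy : ∀ t, HasDerivAt y (v t) t ∧ HasDerivAt v (h t (y t)) t)
    (hz : ∀ t, HasDerivAt z (w t) t ∧ HasDerivAt w (h t (z t)) t)
    (h0 : y t₀ = z t₀) (h1 : v t₀ = w t₀) : y = z ∧ v = w := by
  have := ODE_solution_unique_univ (v := fun t (x : ℝ × ℝ) => (x.2, h t x.1))
    (s := fun _ => Set.univ) (K := max 1 K) (t₀ := t₀)
    (f := fun t => (y t, v t)) (g := fun t => (z t, w t)) (fun t => (lipschitzWith_second_order (hL t)).lipschitzOnWith)
    (fun t => ⟨(hy t).1.prodMk (hy t).2, trivial⟩) (fun t => ⟨(hz t).1.prodMk (hz t).2, trivial⟩)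
    (by simp [h0, h1])
  constructor <;> funext t
  · exact congrArg Prod.fst (congrFun this t)
  · exact congrArg Prod.snd (congrFun this t)

lemma lipschitzWith_hill {q G : ℝ → ℝ} {Q c : ℝ} (hQ : ∀ t, |q t| ≤ Q) (t : ℝ) :
    LipschitzWith (|c| + Q).toNNReal fun y : ℝ => -(c + q t) * y + G t := by
  refine LipschitzWith.of_dist_le_mul fun y z => ?_
  have hq := hQ t
  have hQ0 : 0 ≤ Q := (abs_nonneg _).trans hq
  rw [Real.coe_toNNReal _ (by positivity), Real.dist_eq, Real.dist_eq,
    show -(c + q t) * y + G t - (-(c + q t) * z + G t) = -((c + q t) * (y - z)) by ring, abs_neg,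
    abs_mul]
  gcongr
  exact (abs_add_le _ _).trans (by gcongr)

lemma hill_exists {q G : ℝ → ℝ} {Q : ℝ} (hqc : Continuous q) (hQ : ∀ t, |q t| ≤ Q)
    (hG : Continuous G) (c a b : ℝ) :
    ∃ y v : ℝ → ℝ, y 0 = a ∧ v 0 = b ∧ ∀ t, HasDerivAt y (v t) t ∧
      HasDerivAt v (-(c + q t) * y t + G t) t :=
  exists_second_order_of_lipschitz (lipschitzWith_hill hQ) (fun y => by fun_prop) 0 a b

lemma hill_unique {q G : ℝ → ℝ} {Q c : ℝ} (hQ : ∀ t, |q t| ≤ Q) {y v z w : ℝ → ℝ} {t₀ : ℝ}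
    (hy : ∀ t, HasDerivAt y (v t) t ∧ HasDerivAt v (-(c + q t) * y t + G t) t)
    (hz : ∀ t, HasDerivAt z (w t) t ∧ HasDerivAt w (-(c + q t) * z t + G t) t)
    (h0 : y t₀ = z t₀) (h1 : v t₀ = w t₀) : y = z ∧ v = w :=
  second_order_unique (lipschitzWith_hill hQ) hy hz h0 h1

/-- The Hill equation with potential `c + q` and forcing `G`, as a first-order system with
velocity `v`. -/
def HillSol (q G : ℝ → ℝ) (c : ℝ) (y v : ℝ → ℝ) : Prop :=
  ∀ t, HasDerivAt y (v t) t ∧ HasDerivAt v (-(c + q t) * y t + G t) t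

lemma HillSol.comb {q G : ℝ → ℝ} {c : ℝ} {y v y₁ v₁ y₂ v₂ : ℝ → ℝ} (h : HillSol q G c y v)
    (h₁ : HillSol q 0 c y₁ v₁) (h₂ : HillSol q 0 c y₂ v₂) (a b : ℝ) :
    HillSol q G c (fun t => y t + a * y₁ t + b * y₂ t) (fun t => v t + a * v₁ t + b * v₂ t) := by
  intro t
  refine ⟨((h t).1.add ((h₁ t).1.const_mul a)).add ((h₂ t).1.const_mul b), ?_⟩
  refine (((h t).2.add ((h₁ t).2.const_mul a)).add ((h₂ t).2.const_mul b)).congr_deriv ?_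
  simp only [Pi.zero_apply]
  ring

/-- A solution whose data after one period are `ρ` times its initial data is `ρ`-quasiperiodic. -/
lemma HillSol.quasiperiodic {q G : ℝ → ℝ} {Q c T ρ : ℝ} (hQ : ∀ t, |q t| ≤ Q)
    (hqT : ∀ t, q (t + T) = q t) (hG : ∀ t, G (t + T) = ρ * G t) {y v : ℝ → ℝ}
    (h : HillSol q G c y v) (h0 : y T = ρ * y 0) (h1 : v T = ρ * v 0) :
    (∀ t, y (t + T) = ρ * y t) ∧ ∀ t, v (t + T) = ρ * v t := by
  have := hill_unique (G := fun t => ρ * G t) (c := c) hQ (t₀ := 0)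
    (y := fun t => y (t + T)) (v := fun t => v (t + T))
    (z := fun t => ρ * y t) (w := fun t => ρ * v t)
    (fun t => ⟨(h (t + T)).1.comp_add_const t T, by
      have := (h (t + T)).2.comp_add_const t T
      rwa [hqT, hG] at this⟩)
    (fun t => ⟨(h t).1.const_mul ρ, ((h t).2.const_mul ρ).congr_deriv (by ring)⟩)
    (by simpa using h0) (by simpa using h1)
  exact ⟨congrFun this.1, congrFun this.2⟩

/-- Solvability away from the Floquet multipliers. -/
lemma hill_resolvent {q G : ℝ → ℝ} {Q c T ρ : ℝ} (hqc : Continuous q) (hQ : ∀ t, |q t| ≤ Q)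
    (hqT : ∀ t, q (t + T) = q t) (hGc : Continuous G) (hG : ∀ t, G (t + T) = ρ * G t)
    {y₁ v₁ y₂ v₂ : ℝ → ℝ} (h₁ : HillSol q 0 c y₁ v₁) (h₂ : HillSol q 0 c y₂ v₂)
    (i₁ : y₁ 0 = 1) (j₁ : v₁ 0 = 0) (i₂ : y₂ 0 = 0) (j₂ : v₂ 0 = 1)
    (hdet : (y₁ T - ρ) * (v₂ T - ρ) - y₂ T * v₁ T ≠ 0) :
    ∃ y v, HillSol q G c y v ∧ (∀ t, y (t + T) = ρ * y t) ∧ ∀ t, v (t + T) = ρ * v t := by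
  obtain ⟨y, v, hy0, hv0, h⟩ := hill_exists hqc hQ hGc c 0 0
  set d := (y₁ T - ρ) * (v₂ T - ρ) - y₂ T * v₁ T with hd
  have hs := HillSol.comb h h₁ h₂ (-(y T * (v₂ T - ρ) - y₂ T * v T) / d)
    (-((y₁ T - ρ) * v T - v₁ T * y T) / d)
  refine ⟨_, _, hs, hs.quasiperiodic hQ hqT hG ?_ ?_⟩
  · simp only [hy0, i₁, i₂]
    field_simp
    rw [hd]
    ring
  · simp only [hv0, j₁, j₂]
    field_simp
    rw [hd]
    ring

/-- Existence of a Floquet solution at a root of the characteristic determinant. -/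
lemma hill_floquet {q : ℝ → ℝ} {Q c T ρ : ℝ} (hQ : ∀ t, |q t| ≤ Q)
    (hqT : ∀ t, q (t + T) = q t)
    {y₁ v₁ y₂ v₂ : ℝ → ℝ} (h₁ : HillSol q 0 c y₁ v₁) (h₂ : HillSol q 0 c y₂ v₂)
    (i₁ : y₁ 0 = 1) (j₁ : v₁ 0 = 0) (i₂ : y₂ 0 = 0) (j₂ : v₂ 0 = 1)
    (hdet : (y₁ T - ρ) * (v₂ T - ρ) - y₂ T * v₁ T = 0) :
    ∃ y v, HillSol q 0 c y v ∧ (∀ t, y (t + T) = ρ * y t) ∧ (∀ t, v (t + T) = ρ * v t) ∧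
      ∃ t, y t ≠ 0 := by
  obtain ⟨a, b, hab, e1, e2⟩ : ∃ a b : ℝ, (a ≠ 0 ∨ b ≠ 0) ∧
      (y₁ T - ρ) * a + y₂ T * b = 0 ∧ v₁ T * a + (v₂ T - ρ) * b = 0 := by
    by_cases hA : y₁ T - ρ = 0 ∧ y₂ T = 0
    · by_cases hB : v₁ T = 0 ∧ v₂ T - ρ = 0
      · exact ⟨1, 0, Or.inl one_ne_zero, by simp [hA.1], by simp [hB.1]⟩
      · refine ⟨v₂ T - ρ, -v₁ T, ?_, by rw [hA.1, hA.2]; ring, by ring⟩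
        by_contra! hc
        exact hB ⟨by linarith [hc.2], hc.1⟩
    · refine ⟨y₂ T, -(y₁ T - ρ), ?_, by ring, by linarith⟩
      by_contra! hc
      exact hA ⟨by linarith [hc.2], hc.1⟩
  have hz : HillSol q 0 c 0 0 := fun t => by
    constructor
    · exact hasDerivAt_const t (0 : ℝ)
    · simp
  have hs := hz.comb h₁ h₂ a b
  have hp := hs.quasiperiodic (ρ := ρ) hQ hqT (by simp) (by simp [i₁, i₂]; linarith)
    (by simp [j₁, j₂]; linarith)
  refine ⟨_, _, hs, hp.1, hp.2, ?_⟩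
  by_contra! hall
  have h0 : a = 0 := by simpa [i₁, i₂] using hall 0
  have hd := (hs 0).1
  have hd' : HasDerivAt (fun t => (0 : ℝ → ℝ) t + a * y₁ t + b * y₂ t) 0 0 := by
    rw [show (fun t => (0 : ℝ → ℝ) t + a * y₁ t + b * y₂ t) = fun _ => 0 from funext hall]
    exact hasDerivAt_const _ _
  have h1 : b = 0 := by simpa [j₁, j₂] using hd.unique hd'
  tauto

lemma hill_wronskian {q : ℝ → ℝ} {c : ℝ} {y₁ v₁ y₂ v₂ : ℝ → ℝ} (h₁ : HillSol q 0 c y₁ v₁)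
    (h₂ : HillSol q 0 c y₂ v₂) (t : ℝ) :
    y₁ t * v₂ t - v₁ t * y₂ t = y₁ 0 * v₂ 0 - v₁ 0 * y₂ 0 := by
  have hd : ∀ t, HasDerivAt (fun t => y₁ t * v₂ t - v₁ t * y₂ t) 0 t := fun t =>
    (((h₁ t).1.mul (h₂ t).2).sub ((h₁ t).2.mul (h₂ t).1)).congr_deriv (by
      simp only [Pi.zero_apply]; ring)
  exact is_const_of_deriv_eq_zero (fun t => (hd t).differentiableAt) (fun t => (hd t).deriv) t 0

/-- Lipschitz dependence on the spectral parameter over one period. -/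
lemma hill_param {q : ℝ → ℝ} {Q c₀ T : ℝ} (hQ : ∀ t, |q t| ≤ Q) (hT : 0 < T)
    {y₀ v₀ : ℝ → ℝ} (h₀ : HillSol q 0 c₀ y₀ v₀) :
    ∃ C, 0 ≤ C ∧ ∀ c ∈ Set.Icc (0 : ℝ) 1, ∀ y v, HillSol q 0 c y v → y 0 = y₀ 0 → v 0 = v₀ 0 →
      ∀ t ∈ Set.Icc 0 T, |y t - y₀ t| ≤ C * |c - c₀| ∧ |v t - v₀ t| ≤ C * |c - c₀| := by
  have hQ0 : 0 ≤ Q := (abs_nonneg _).trans (hQ 0)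
  have hyc : Continuous y₀ := continuous_iff_continuousAt.2 fun t => (h₀ t).1.continuousAt
  obtain ⟨B, hB⟩ := (isCompact_Icc (a := 0) (b := T)).exists_bound_of_continuousOn
    hyc.continuousOn
  have hB0 : 0 ≤ B := (norm_nonneg _).trans (hB 0 ⟨le_rfl, hT.le⟩)
  set K : ℝ≥0 := max 1 (1 + Q).toNNReal with hK
  have hK1 : (1 : ℝ) ≤ K := by exact_mod_cast le_max_left _ _
  refine ⟨B / K * Real.exp (K * T), by positivity, fun c hc y v h e0 e1 t ht => ?_⟩
  have hgr := dist_le_of_approx_trajectories_ODE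
    (v := fun t (x : ℝ × ℝ) => (x.2, -(c + q t) * x.1 + 0)) (K := K)
    (f := fun t => (y t, v t)) (g := fun t => (y₀ t, v₀ t)) (a := 0) (b := T)
    (f' := fun t => (v t, -(c + q t) * y t + 0)) (g' := fun t => (v₀ t, -(c₀ + q t) * y₀ t + 0))
    (εf := 0) (εg := B * |c - c₀|) (δ := 0)
    (fun t => (lipschitzWith_second_order (lipschitzWith_hill (G := 0) hQ t)).weaken (by
      rw [hK]
      gcongr
      rw [abs_le]; constructor <;> linarith [hc.1, hc.2]))
    (fun t _ => ((h t).1.prodMk (h t).2).continuousAt.continuousWithinAt)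
    (fun t _ => ((h t).1.prodMk (h t).2).hasDerivWithinAt)
    (fun t _ => by simp)
    (fun t _ => ((h₀ t).1.prodMk (h₀ t).2).continuousAt.continuousWithinAt)
    (fun t _ => ((h₀ t).1.prodMk (h₀ t).2).hasDerivWithinAt)
    (fun t ht => by
      have h2 := hB t ⟨ht.1, ht.2.le⟩
      rw [Real.norm_eq_abs] at h2
      rw [Prod.dist_eq, dist_self, Real.dist_eq, show -(c₀ + q t) * y₀ t + 0 -
        (-(c + q t) * y₀ t + 0) = y₀ t * (c - c₀) by ring, abs_mul]
      exact max_le (by positivity) (by gcongr))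
    (by simp [e0, e1]) t ht
  have hle : gronwallBound 0 K (0 + B * |c - c₀|) (t - 0) ≤
      B / K * Real.exp (K * T) * |c - c₀| := by
    rw [gronwallBound_of_K_ne_0 (by positivity)]
    have : Real.exp (K * (t - 0)) - 1 ≤ Real.exp (K * T) := by
      have : Real.exp (K * (t - 0)) ≤ Real.exp (K * T) := by
        gcongr; linarith [ht.2]
      linarith
    calc _ = B / K * |c - c₀| * (Real.exp (K * (t - 0)) - 1) := by ring
      _ ≤ B / K * |c - c₀| * Real.exp (K * T) := by gcongr
      _ = _ := by ring
  have := hgr.trans hle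
  rw [Prod.dist_eq, max_le_iff] at this
  exact this

/-- A normalized fundamental system of the homogeneous Hill equation for every `c`. -/
structure HillFundamental (q : ℝ → ℝ) (Y₁ V₁ Y₂ V₂ : ℝ → ℝ → ℝ) : Prop where
  sol₁ : ∀ c, HillSol q 0 c (Y₁ c) (V₁ c)
  sol₂ : ∀ c, HillSol q 0 c (Y₂ c) (V₂ c)
  init_Y₁ : ∀ c, Y₁ c 0 = 1
  init_V₁ : ∀ c, V₁ c 0 = 0
  init_Y₂ : ∀ c, Y₂ c 0 = 0
  init_V₂ : ∀ c, V₂ c 0 = 1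

lemma hillSol_zero (q : ℝ → ℝ) (c : ℝ) : HillSol q 0 c 0 0 := fun t => by
  constructor
  · exact hasDerivAt_const t (0 : ℝ)
  · simp

lemma exists_hillFundamental {q : ℝ → ℝ} {Q : ℝ} (hqc : Continuous q) (hQ : ∀ t, |q t| ≤ Q) :
    ∃ Y₁ V₁ Y₂ V₂, HillFundamental q Y₁ V₁ Y₂ V₂ := by
  choose Y₁ V₁ a1 b1 h1 using fun c =>
    hill_exists (G := 0) hqc hQ continuous_const c 1 0
  choose Y₂ V₂ a2 b2 h2 using fun c =>
    hill_exists (G := 0) hqc hQ continuous_const c 0 1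
  exact ⟨Y₁, V₁, Y₂, V₂, h1, h2, a1, b1, a2, b2⟩

lemma HillFundamental.det_eq {q : ℝ → ℝ} {Y₁ V₁ Y₂ V₂ : ℝ → ℝ → ℝ}
    (hf : HillFundamental q Y₁ V₁ Y₂ V₂) (c T ρ : ℝ) :
    (Y₁ c T - ρ) * (V₂ c T - ρ) - Y₂ c T * V₁ c T = 1 - ρ * (Y₁ c T + V₂ c T) + ρ ^ 2 := by
  have := hill_wronskian (hf.sol₁ c) (hf.sol₂ c) T
  rw [hf.init_Y₁, hf.init_V₁, hf.init_Y₂, hf.init_V₂] at this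
  linear_combination this

lemma HillFundamental.continuousOn_trace {q : ℝ → ℝ} {Q T : ℝ} {Y₁ V₁ Y₂ V₂ : ℝ → ℝ → ℝ}
    (hf : HillFundamental q Y₁ V₁ Y₂ V₂) (hQ : ∀ t, |q t| ≤ Q) (hT : 0 < T) :
    ContinuousOn (fun c => Y₁ c T + V₂ c T) (Set.Icc 0 1) := by
  intro c₀ hc₀
  obtain ⟨C₁, h0₁, h₁⟩ := hill_param hQ hT (hf.sol₁ c₀)
  obtain ⟨C₂, h0₂, h₂⟩ := hill_param hQ hT (hf.sol₂ c₀)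
  rw [ContinuousWithinAt, tendsto_iff_norm_sub_tendsto_zero]
  have hlim : Tendsto (fun c => (C₁ + C₂) * |c - c₀|) (𝓝[Set.Icc 0 1] c₀) (𝓝 0) := by
    have : Continuous fun c => (C₁ + C₂) * |c - c₀| := by fun_prop
    simpa using (this.tendsto c₀).mono_left nhdsWithin_le_nhds
  refine squeeze_zero' (Eventually.of_forall fun _ => norm_nonneg _) ?_ hlim
  filter_upwards [self_mem_nhdsWithin] with c hc
  have e₁ := (h₁ c hc _ _ (hf.sol₁ c) (by rw [hf.init_Y₁, hf.init_Y₁])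
    (by rw [hf.init_V₁, hf.init_V₁]) T ⟨hT.le, le_rfl⟩).1
  have e₂ := (h₂ c hc _ _ (hf.sol₂ c) (by rw [hf.init_Y₂, hf.init_Y₂])
    (by rw [hf.init_V₂, hf.init_V₂]) T ⟨hT.le, le_rfl⟩).2
  rw [Real.norm_eq_abs]
  calc |Y₁ c T + V₂ c T - (Y₁ c₀ T + V₂ c₀ T)|
      = |(Y₁ c T - Y₁ c₀ T) + (V₂ c T - V₂ c₀ T)| := by ring_nf
    _ ≤ |Y₁ c T - Y₁ c₀ T| + |V₂ c T - V₂ c₀ T| := abs_add_le _ _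
    _ ≤ (C₁ + C₂) * |c - c₀| := by linarith

/-- Lower bound for the discriminant just below the degenerate value `c = 1`, where the monodromy
has a Jordan block with positive off-diagonal entry `β`. -/
lemma HillFundamental.trace_lower {q : ℝ → ℝ} {Q T β : ℝ} {Y₁ V₁ Y₂ V₂ : ℝ → ℝ → ℝ}
    (hf : HillFundamental q Y₁ V₁ Y₂ V₂) (hQ : ∀ t, |q t| ≤ Q) (hT : 0 < T)
    {u₁ v₁ u₂ v₂ : ℝ → ℝ} (h₁ : HillSol q 0 1 u₁ v₁) (h₂ : HillSol q 0 1 u₂ v₂)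
    (hu₁ : u₁ T = u₁ 0) (hv₁ : v₁ T = v₁ 0) (hu₂ : u₂ T = u₂ 0 + β * u₁ 0)
    (hv₂ : v₂ T = v₂ 0 + β * v₁ 0) (hβ : 0 < β) (hW : 0 < u₁ 0 * v₂ 0 - v₁ 0 * u₂ 0)
    (hne : ∃ t ∈ Set.Icc 0 T, u₁ t ≠ 0) :
    ∃ k C, 0 < k ∧ 0 ≤ C ∧ ∀ c ∈ Set.Icc (0 : ℝ) 1,
      2 + (1 - c) * (k - C * (1 - c)) ≤ Y₁ c T + V₂ c T := by
  obtain ⟨C₁, hC₁, hp₁⟩ := hill_param hQ hT h₁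
  obtain ⟨C₂, hC₂, hp₂⟩ := hill_param hQ hT h₂
  have hc₁ : Continuous u₁ := continuous_iff_continuousAt.2 fun t => (h₁ t).1.continuousAt
  have hc₂ : Continuous u₂ := continuous_iff_continuousAt.2 fun t => (h₂ t).1.continuousAt
  obtain ⟨B₁, hB₁⟩ := (isCompact_Icc (a := 0) (b := T)).exists_bound_of_continuousOn
    hc₁.continuousOn
  obtain ⟨B₂, hB₂⟩ := (isCompact_Icc (a := 0) (b := T)).exists_bound_of_continuousOn
    hc₂.continuousOn
  have hB₁0 : 0 ≤ B₁ := (norm_nonneg _).trans (hB₁ 0 ⟨le_rfl, hT.le⟩)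
  have hB₂0 : 0 ≤ B₂ := (norm_nonneg _).trans (hB₂ 0 ⟨le_rfl, hT.le⟩)
  set W := u₁ 0 * v₂ 0 - v₁ 0 * u₂ 0 with hWdef
  set J : ℝ → ℝ := fun t => ∫ s in (0 : ℝ)..t, u₁ s ^ 2 with hJ
  have hJd : ∀ t, HasDerivAt J (u₁ t ^ 2) t := fun t =>
    have hsq : Continuous fun s => u₁ s ^ 2 := hc₁.pow 2
    intervalIntegral.integral_hasDerivAt_right (hsq.intervalIntegrable _ _)
      (hsq.stronglyMeasurableAtFilter _ _) hsq.continuousAt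
  have hJT : 0 < J T := by
    obtain ⟨s, hs, hs0⟩ := hne
    exact intervalIntegral.integral_pos hT (hc₁.pow 2).continuousOn (fun _ _ => sq_nonneg _)
      ⟨s, hs, by positivity⟩
  set D := β * C₁ * B₁ + C₁ * B₂ + B₁ * C₂ with hD
  have hD0 : 0 ≤ D := by positivity
  refine ⟨β * J T / W, D * T / W, by positivity, by positivity, fun c hc => ?_⟩
  have hs₁ := (hillSol_zero q c).comb (hf.sol₁ c) (hf.sol₂ c) (u₁ 0) (v₁ 0)
  have hs₂ := (hillSol_zero q c).comb (hf.sol₁ c) (hf.sol₂ c) (u₂ 0) (v₂ 0)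
  have b₁ := hp₁ c hc _ _ hs₁ (by simp [hf.init_Y₁, hf.init_Y₂])
    (by simp [hf.init_V₁, hf.init_V₂])
  have b₂ := hp₂ c hc _ _ hs₂ (by simp [hf.init_Y₁, hf.init_Y₂])
    (by simp [hf.init_V₁, hf.init_V₂])
  have i₁ : u₁ 0 * Y₁ c T + v₁ 0 * Y₂ c T = (0 : ℝ → ℝ) T + u₁ 0 * Y₁ c T + v₁ 0 * Y₂ c T := by simp
  set U₁ := fun t => (0 : ℝ → ℝ) t + u₁ 0 * Y₁ c t + v₁ 0 * Y₂ c t with hU₁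
  set P₁ := fun t => (0 : ℝ → ℝ) t + u₁ 0 * V₁ c t + v₁ 0 * V₂ c t with hP₁
  set U₂ := fun t => (0 : ℝ → ℝ) t + u₂ 0 * Y₁ c t + v₂ 0 * Y₂ c t with hU₂
  set P₂ := fun t => (0 : ℝ → ℝ) t + u₂ 0 * V₁ c t + v₂ 0 * V₂ c t with hP₂
  have habs : |c - 1| = 1 - c := by rw [abs_sub_comm, abs_of_nonneg]; linarith [hc.2]
  set Ψ : ℝ → ℝ := fun t => (U₁ t * v₂ t - P₁ t * u₂ t) - β * (U₁ t * v₁ t - P₁ t * u₁ t)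
    + (u₁ t * P₂ t - v₁ t * U₂ t) - (1 - c) * (β * J t - D * (1 - c) * t) with hΨ
  have hΨd : ∀ t, HasDerivAt Ψ ((1 - c) * (β * U₁ t * u₁ t - U₁ t * u₂ t + u₁ t * U₂ t)
      - (1 - c) * (β * u₁ t ^ 2 - D * (1 - c))) t := by
    intro t
    have e1 := ((hs₁ t).1.mul (h₂ t).2).sub ((hs₁ t).2.mul (h₂ t).1)
    have e2 := (((hs₁ t).1.mul (h₁ t).2).sub ((hs₁ t).2.mul (h₁ t).1)).const_mul β
    have e3 := ((h₁ t).1.mul (hs₂ t).2).sub ((h₁ t).2.mul (hs₂ t).1)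
    have e4 := (((hJd t).const_mul β).sub ((hasDerivAt_id t).const_mul (D * (1 - c)))).const_mul
      (1 - c)
    refine (((e1.sub e2).add e3).sub e4).congr_deriv ?_
    simp only [Pi.zero_apply]
    ring
  have hmono : MonotoneOn Ψ (Set.Icc 0 T) := by
    refine monotoneOn_of_deriv_nonneg (convex_Icc 0 T)
      (fun t _ => (hΨd t).continuousAt.continuousWithinAt)
      (fun t _ => (hΨd t).differentiableAt.differentiableWithinAt) (fun t ht => ?_)
    rw [interior_Icc] at ht
    have ht' := Set.Ioo_subset_Icc_self ht
    rw [(hΨd t).deriv]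
    have a1 := (b₁ t ht').1
    have a2 := (b₂ t ht').1
    rw [habs] at a1 a2
    have n1 := hB₁ t ht'
    have n2 := hB₂ t ht'
    rw [Real.norm_eq_abs] at n1 n2
    have hc1 : 0 ≤ 1 - c := by linarith [hc.2]
    have m1 : |β * ((U₁ t - u₁ t) * u₁ t)| ≤ β * (C₁ * (1 - c) * B₁) := by
      rw [abs_mul, abs_mul, abs_of_pos hβ]; gcongr
    have m2 : |(U₁ t - u₁ t) * u₂ t| ≤ C₁ * (1 - c) * B₂ := by
      rw [abs_mul]; gcongr
    have m3 : |u₁ t * (U₂ t - u₂ t)| ≤ B₁ * (C₂ * (1 - c)) := by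
      rw [abs_mul]; gcongr
    have key : 0 ≤ β * ((U₁ t - u₁ t) * u₁ t) - (U₁ t - u₁ t) * u₂ t + u₁ t * (U₂ t - u₂ t)
        + D * (1 - c) := by
      rw [hD]
      linarith [(abs_le.1 m1).1, (abs_le.1 m2).2, (abs_le.1 m3).1]
    calc 0 ≤ (1 - c) * (β * ((U₁ t - u₁ t) * u₁ t) - (U₁ t - u₁ t) * u₂ t
          + u₁ t * (U₂ t - u₂ t) + D * (1 - c)) := mul_nonneg hc1 key
      _ = _ := by ring
  have hfin := hmono ⟨le_rfl, hT.le⟩ ⟨hT.le, le_rfl⟩ hT.le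
  have hJ0 : J 0 = 0 := by simp [hJ]
  have hΨ0 : Ψ 0 = 2 * W := by
    simp only [hΨ, hU₁, hU₂, hP₁, hP₂, Pi.zero_apply, hf.init_Y₁, hf.init_Y₂, hf.init_V₁,
      hf.init_V₂, hJ0, hWdef]
    ring
  have hΨT : Ψ T = W * (Y₁ c T + V₂ c T) - (1 - c) * (β * J T - D * (1 - c) * T) := by
    simp only [hΨ, hU₁, hU₂, hP₁, hP₂, Pi.zero_apply, hu₁, hu₂, hv₁, hv₂, hWdef]
    ring
  rw [hΨ0, hΨT] at hfin
  have : 2 + (1 - c) * (β * J T / W - D * T / W * (1 - c))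
      = (2 * W + (1 - c) * (β * J T - D * (1 - c) * T)) / W := by
    field_simp
  rw [this, div_le_iff₀ hW]
  linarith

/-- The largest real multiplier `ρ > 1` of the delayed linearization. -/
lemma exists_largest_multiplier {D : ℝ → ℝ} (hD : ContinuousOn D (Set.Icc 0 1)) {k C : ℝ}
    (hk : 0 < k) (hC : 0 ≤ C)
    (hlow : ∀ c ∈ Set.Icc (0 : ℝ) 1, 2 + (1 - c) * (k - C * (1 - c)) ≤ D c) :
    ∃ ρ > 1, 1 - ρ * D ρ⁻¹ + ρ ^ 2 = 0 ∧ ∀ r > ρ, 1 - r * D r⁻¹ + r ^ 2 ≠ 0 := by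
  obtain ⟨B, hB⟩ := isCompact_Icc.exists_bound_of_continuousOn hD
  set χ : ℝ → ℝ := fun r => 1 - r * D r⁻¹ + r ^ 2 with hχ
  have hinv : ∀ r : ℝ, 1 ≤ r → r⁻¹ ∈ Set.Icc (0 : ℝ) 1 := fun r hr =>
    ⟨by positivity, inv_le_one_of_one_le₀ hr⟩
  have hχc : ContinuousOn χ (Set.Ici 1) := by
    have h1 : ContinuousOn (fun r : ℝ => r⁻¹) (Set.Ici 1) := by
      refine continuousOn_inv₀.mono fun r hr => ?_
      have : (1 : ℝ) ≤ r := hr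
      simp; linarith
    have h2 : ContinuousOn (fun r : ℝ => D r⁻¹) (Set.Ici 1) := hD.comp h1 fun r hr => hinv r hr
    exact (continuousOn_const.sub (continuousOn_id.mul h2)).add (continuousOn_id.pow 2)
  have hpos : ∀ r, 1 ≤ r → B ≤ r → 0 < χ r := by
    intro r hr hrB
    have h1 := (abs_le.1 ((hB _ (hinv r hr)).trans hrB)).2
    have : r * D r⁻¹ ≤ r * r := by gcongr
    simp only [hχ]
    nlinarith
  set r₁ := 1 + k / (2 * (1 + C)) with hr₁
  have hr₁1 : 1 < r₁ := by rw [hr₁]; linarith [show 0 < k / (2 * (1 + C)) by positivity]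
  have hneg : χ r₁ ≤ 0 := by
    have h1 := hlow _ (hinv r₁ hr₁1.le)
    have e : r₁ * (1 - r₁⁻¹) = r₁ - 1 := by field_simp
    have h2 : r₁ * (2 + (1 - r₁⁻¹) * (k - C * (1 - r₁⁻¹))) ≤ r₁ * D r₁⁻¹ := by gcongr
    have h3 : 1 - r₁⁻¹ ≤ r₁ - 1 := by
      rw [← e]
      have := sub_nonneg.2 (hinv r₁ hr₁1.le).2
      nlinarith
    have h4 : (r₁ - 1) * (1 + C) ≤ k := by
      rw [hr₁]; field_simp; linarith
    have h5 : r₁ * (2 + (1 - r₁⁻¹) * (k - C * (1 - r₁⁻¹))) =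
        2 * r₁ + (r₁ - 1) * (k - C * (1 - r₁⁻¹)) := by rw [← e]; ring
    have h6 : C * (1 - r₁⁻¹) ≤ C * (r₁ - 1) := by gcongr
    have h7 : (r₁ - 1) * (r₁ - 1) ≤ (r₁ - 1) * (k - C * (1 - r₁⁻¹)) :=
      mul_le_mul_of_nonneg_left (by linarith) (by linarith)
    simp only [hχ]
    nlinarith
  set M := max r₁ B with hM
  set S := {r ∈ Set.Icc r₁ M | χ r ≤ 0} with hS
  have hScomp : IsCompact S := by
    have : ContinuousOn χ (Set.Icc r₁ M) := hχc.mono fun r hr => hr₁1.le.trans hr.1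
    have := this.preimage_isClosed_of_isClosed isClosed_Icc (isClosed_Iic (a := (0 : ℝ)))
    exact (isCompact_Icc.of_isClosed_subset this Set.inter_subset_left)
  obtain ⟨ρ, hρS, hρmax⟩ := hScomp.exists_isGreatest ⟨r₁, ⟨le_rfl, le_max_left _ _⟩, hneg⟩
  have hρ1 : 1 < ρ := hr₁1.trans_le hρS.1.1
  have hbig : ∀ r > ρ, 0 < χ r := by
    intro r hr
    by_contra! hcon
    rcases le_total r M with h | h
    · exact absurd (hρmax ⟨⟨hρS.1.1.trans hr.le, h⟩, hcon⟩) (not_le.2 hr)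
    · exact absurd (hpos r (hρ1.trans hr).le ((le_max_right _ _).trans h)) (not_lt.2 hcon)
  refine ⟨ρ, hρ1, ?_, fun r hr => (hbig r hr).ne'⟩
  refine le_antisymm hρS.2 ?_
  have hcw : Tendsto χ (𝓝[>] ρ) (𝓝 (χ ρ)) :=
    (hχc ρ hρ1.le).mono_left (nhdsWithin_mono _ fun r hr => (hρ1.trans hr).le)
  exact ge_of_tendsto hcw (by filter_upwards [self_mem_nhdsWithin] with r hr using (hbig r hr).le)

/-- `w` is a `T`-periodic solution of `(d/dt + a)² w + (exp (-a T) + q) w = F`,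
with `g = (d/dt + a) w`. -/
structure PeriodicSol (T : ℝ) (q : ℝ → ℝ) (a : ℝ) (F w g : ℝ → ℝ) : Prop where
  periodic_w : ∀ t, w (t + T) = w t
  periodic_g : ∀ t, g (t + T) = g t
  deriv_w : ∀ t, HasDerivAt w (g t - a * w t) t
  deriv_g : ∀ t, HasDerivAt g (F t - (Real.exp (-(a * T)) + q t) * w t - a * g t) t

lemma PeriodicSol.of_hillSol {T a : ℝ} {q F y v : ℝ → ℝ}
    (h : HillSol q (fun t => Real.exp (a * t) * F t) (Real.exp (-(a * T))) y v)
    (hy : ∀ t, y (t + T) = Real.exp (a * T) * y t) (hv : ∀ t, v (t + T) = Real.exp (a * T) * v t) :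
    PeriodicSol T q a F (fun t => Real.exp (-(a * t)) * y t) (fun t => Real.exp (-(a * t)) * v t) := by
  have hper : ∀ t, Real.exp (-(a * (t + T))) * Real.exp (a * T) = Real.exp (-(a * t)) := fun t => by
    rw [← Real.exp_add]; ring_nf
  have hd : ∀ t, HasDerivAt (fun t => Real.exp (-(a * t))) (Real.exp (-(a * t)) * (-(a * 1))) t :=
    fun t => (((hasDerivAt_id t).const_mul a).neg).exp
  refine ⟨fun t => ?_, fun t => ?_, fun t => ?_, fun t => ?_⟩
  · rw [hy, ← mul_assoc, hper]
  · rw [hv, ← mul_assoc, hper]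
  · exact ((hd t).mul (h t).1).congr_deriv (by ring)
  · refine ((hd t).mul (h t).2).congr_deriv ?_
    have : Real.exp (-(a * t)) * Real.exp (a * t) = 1 := by rw [← Real.exp_add]; simp
    linear_combination F t * this

/-- The largest positive real Floquet exponent `lam` of the delayed linearization, together with
solvability of the periodic problem for all larger exponents. -/
theorem exists_largest_exponent {q : ℝ → ℝ} {Q T β : ℝ} (hqc : Continuous q)
    (hQ : ∀ t, |q t| ≤ Q) (hqT : ∀ t, q (t + T) = q t) (hT : 0 < T)
    {u₁ v₁ u₂ v₂ : ℝ → ℝ} (h₁ : HillSol q 0 1 u₁ v₁) (h₂ : HillSol q 0 1 u₂ v₂)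
    (hu₁ : u₁ T = u₁ 0) (hv₁ : v₁ T = v₁ 0) (hu₂ : u₂ T = u₂ 0 + β * u₁ 0)
    (hv₂ : v₂ T = v₂ 0 + β * v₁ 0) (hβ : 0 < β) (hW : 0 < u₁ 0 * v₂ 0 - v₁ 0 * u₂ 0)
    (hne : ∃ t ∈ Set.Icc 0 T, u₁ t ≠ 0) :
    ∃ lam > 0, (∃ w g, PeriodicSol T q lam 0 w g ∧ ∃ t, w t ≠ 0) ∧
      ∀ a > lam, ∀ F : ℝ → ℝ, Continuous F → (∀ t, F (t + T) = F t) →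
        ∃ w g, PeriodicSol T q a F w g := by
  obtain ⟨Y₁, V₁, Y₂, V₂, hf⟩ := exists_hillFundamental hqc hQ
  obtain ⟨k, C, hk, hC, hlow⟩ := hf.trace_lower hQ hT h₁ h₂ hu₁ hv₁ hu₂ hv₂ hβ hW hne
  obtain ⟨ρ, hρ1, hρ0, hρmax⟩ :=
    exists_largest_multiplier (hf.continuousOn_trace hQ hT) hk hC hlow
  have hρpos : 0 < ρ := by linarith
  have hexp : Real.exp (Real.log ρ / T * T) = ρ := by
    rw [div_mul_cancel₀ _ hT.ne', Real.exp_log hρpos]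
  refine ⟨Real.log ρ / T, div_pos (Real.log_pos hρ1) hT, ?_, fun a ha F hF hFT => ?_⟩
  · obtain ⟨y, v, hs, hy, hv, t, ht⟩ := hill_floquet (ρ := ρ) hQ hqT (hf.sol₁ ρ⁻¹) (hf.sol₂ ρ⁻¹)
      (hf.init_Y₁ _) (hf.init_V₁ _) (hf.init_Y₂ _) (hf.init_V₂ _) (by rw [hf.det_eq, hρ0])
    refine ⟨_, _, PeriodicSol.of_hillSol (y := y) (v := v) ?_ (by rwa [hexp]) (by rwa [hexp]), t,
      mul_ne_zero (Real.exp_ne_zero _) ht⟩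
    rw [Real.exp_neg, hexp]
    convert hs using 1
    ext t
    simp
  · have hr : ρ < Real.exp (a * T) := by
      rw [← hexp]
      exact Real.exp_lt_exp.2 (by gcongr)
    obtain ⟨y, v, hs, hy, hv⟩ := hill_resolvent (ρ := Real.exp (a * T)) (T := T)
      (G := fun t => Real.exp (a * t) * F t) hqc hQ hqT (by fun_prop)
      (fun t => by rw [hFT, mul_add, Real.exp_add]; ring)
      (hf.sol₁ (Real.exp (a * T))⁻¹) (hf.sol₂ (Real.exp (a * T))⁻¹)
      (hf.init_Y₁ _) (hf.init_V₁ _) (hf.init_Y₂ _) (hf.init_V₂ _)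
      (by rw [hf.det_eq]; exact hρmax _ hr)
    rw [← Real.exp_neg] at hs
    exact ⟨_, _, PeriodicSol.of_hillSol hs hy hv⟩

/-- Maximum principle for a periodic solution of `(d/dt + a) w = h`. -/
lemma abs_le_of_periodic {w h : ℝ → ℝ} {T a B : ℝ} (hT : 0 < T) (ha : 0 < a)
    (hw : ∀ t, w (t + T) = w t) (hd : ∀ t, HasDerivAt w (h t - a * w t) t)
    (hB : ∀ t, |h t| ≤ B) (t : ℝ) : |w t| ≤ B / a := by
  have key : ∀ (w h : ℝ → ℝ), (∀ t, w (t + T) = w t) → (∀ t, HasDerivAt w (h t - a * w t) t) →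
      (∀ t, |h t| ≤ B) → ∀ t, w t ≤ B / a := by
    intro w h hw hd hB t
    have hc : Continuous w := continuous_iff_continuousAt.2 fun t => (hd t).continuousAt
    obtain ⟨s, hs, hmax⟩ := isCompact_Icc.exists_isMaxOn (Set.nonempty_Icc.2 hT.le) hc.continuousOn
    have hall : ∀ r, w r ≤ w s := by
      intro r
      obtain ⟨r', hr', he⟩ := Function.Periodic.exists_mem_Ico₀ (f := w) hw hT r
      rw [he]
      exact hmax (Set.Ico_subset_Icc_self hr')
    have h0 : h s - a * w s = 0 :=
      IsLocalMax.hasDerivAt_eq_zero (Eventually.of_forall hall) (hd s)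
    refine (hall t).trans ?_
    rw [le_div_iff₀ ha]
    linarith [(abs_le.1 (hB s)).2]
  refine abs_le.2 ⟨?_, key w h hw hd hB t⟩
  have := key (fun t => -w t) (fun t => -h t) (fun t => by rw [hw]) (fun t =>
    (hd t).neg.congr_deriv (by ring)) (fun t => by rw [abs_neg]; exact hB t) t
  linarith

section bounds
variable {T Q a M A : ℝ} {q F w g : ℝ → ℝ}

lemma PeriodicSol.continuous_w (h : PeriodicSol T q a F w g) : Continuous w :=
  continuous_iff_continuousAt.2 fun t => (h.deriv_w t).continuousAt

lemma PeriodicSol.abs_rhs_le (ha : 0 < a) (hT : 0 < T)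
    (hQ : ∀ t, |q t| ≤ Q) (hF : ∀ t, |F t| ≤ M) (hA : ∀ t, |w t| ≤ A) (t : ℝ) :
    |F t - (Real.exp (-(a * T)) + q t) * w t| ≤ M + (1 + Q) * A := by
  have h1 : |Real.exp (-(a * T)) + q t| ≤ 1 + Q := by
    refine (abs_add_le _ _).trans (add_le_add ?_ (hQ t))
    rw [abs_of_pos (Real.exp_pos _)]
    exact Real.exp_le_one_iff.2 (by have := mul_pos ha hT; linarith)
  refine (abs_sub _ _).trans (add_le_add (hF t) ?_)
  rw [abs_mul]
  have := (abs_nonneg _).trans h1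
  gcongr
  exact hA t

lemma PeriodicSol.abs_g_le (h : PeriodicSol T q a F w g) (ha : 0 < a) (hT : 0 < T)
    (hQ : ∀ t, |q t| ≤ Q) (hF : ∀ t, |F t| ≤ M) (hA : ∀ t, |w t| ≤ A) (t : ℝ) :
    |g t| ≤ (M + (1 + Q) * A) / a :=
  abs_le_of_periodic hT ha h.periodic_g h.deriv_g (abs_rhs_le ha hT hQ hF hA) t

lemma exists_abs_max_of_periodic (hT : 0 < T) (hc : Continuous w) (hw : ∀ t, w (t + T) = w t) :
    ∃ s, ∀ t, |w t| ≤ |w s| := by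
  obtain ⟨s, hs, hmax⟩ := isCompact_Icc.exists_isMaxOn (Set.nonempty_Icc.2 hT.le)
    hc.abs.continuousOn
  refine ⟨s, fun t => ?_⟩
  obtain ⟨r', hr', he⟩ := Function.Periodic.exists_mem_Ico₀ (f := w) hw hT t
  rw [he]
  exact hmax (Set.Ico_subset_Icc_self hr')

/-- For large exponents the periodic problem is uniformly well conditioned. -/
lemma PeriodicSol.abs_w_le (h : PeriodicSol T q a F w g) (ha : 0 < a) (hT : 0 < T)
    (hQ : ∀ t, |q t| ≤ Q) (hF : ∀ t, |F t| ≤ M) (hlarge : 2 * (1 + Q) ≤ a ^ 2) (t : ℝ) :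
    |w t| ≤ 2 * M / a ^ 2 := by
  obtain ⟨s, hs⟩ := exists_abs_max_of_periodic hT h.continuous_w h.periodic_w
  have h1 := abs_le_of_periodic hT ha h.periodic_w h.deriv_w (h.abs_g_le ha hT hQ hF hs) s
  rw [div_div, ← sq, le_div_iff₀ (by positivity)] at h1
  refine (hs t).trans ?_
  rw [le_div_iff₀ (by positivity)]
  nlinarith [abs_nonneg (w s)]

end bounds

/-- The linearization of the Duffing equation along a periodic solution satisfies the hypotheses
of `exists_largest_exponent`; the second solution is explicit. -/
theorem duffing_exists_exponent {x v : ℝ → ℝ} {T : ℝ} (hT : 0 < T)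
    (hx : ∀ t, HasDerivAt x (v t) t) (hv : ∀ t, HasDerivAt v (-x t - x t ^ 3) t)
    (hxT : ∀ t, x (t + T) = x t) (hvT : ∀ t, v (t + T) = v t) (hnc : ¬ ∃ c, ∀ t, x t = c) :
    ∃ lam > 0, (∃ w g, PeriodicSol T (fun t => 3 * x t ^ 2) lam 0 w g ∧ ∃ t, w t ≠ 0) ∧
      ∀ a > lam, ∀ F : ℝ → ℝ, Continuous F → (∀ t, F (t + T) = F t) →
        ∃ w g, PeriodicSol T (fun t => 3 * x t ^ 2) a F w g := by
  have hxc : Continuous x := continuous_iff_continuousAt.2 fun t => (hx t).continuousAt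
  set E := v 0 ^ 2 / 2 + x 0 ^ 2 / 2 + x 0 ^ 4 / 4 with hEdef
  have hE : ∀ t, v t ^ 2 / 2 + x t ^ 2 / 2 + x t ^ 4 / 4 = E := by
    have hd : ∀ t, HasDerivAt (fun t => v t ^ 2 / 2 + x t ^ 2 / 2 + x t ^ 4 / 4) 0 t := fun t =>
      (((((hv t).pow 2).div_const 2).add (((hx t).pow 2).div_const 2)).add
        (((hx t).pow 4).div_const 4)).congr_deriv (by push_cast; ring)
    exact fun t => is_const_of_deriv_eq_zero (fun t => (hd t).differentiableAt)
      (fun t => (hd t).deriv) t 0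
  have hE0 : 0 < E := by
    refine lt_of_le_of_ne (by positivity) fun h => hnc ⟨0, fun t => ?_⟩
    have := hE t
    rw [← h] at this
    have : x t ^ 2 = 0 := by nlinarith [sq_nonneg (v t), sq_nonneg (x t), sq_nonneg (x t ^ 2)]
    exact pow_eq_zero_iff two_ne_zero |>.1 this
  set I : ℝ → ℝ := fun t => ∫ s in (0 : ℝ)..t, x s ^ 2 with hI
  have hId : ∀ t, HasDerivAt I (x t ^ 2) t := fun t =>
    have hsq : Continuous fun s => x s ^ 2 := hxc.pow 2
    intervalIntegral.integral_hasDerivAt_right (hsq.intervalIntegrable _ _)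
      (hsq.stronglyMeasurableAtFilter _ _) hsq.continuousAt
  have hI0 : I 0 = 0 := by simp [hI]
  have hmd : ∀ t, HasDerivAt (fun t => 4 * E * t - I t) (4 * E - x t ^ 2) t := fun t =>
    (((hasDerivAt_id t).const_mul (4 * E)).sub (hId t)).congr_deriv (by simp)
  have hβ : 0 < 4 * E * T - I T := by
    have hsm : StrictMono fun t => 4 * E * t - I t := by
      refine strictMono_of_deriv_pos fun t => ?_
      rw [(hmd t).deriv]
      nlinarith [hE t, sq_nonneg (v t), sq_nonneg (x t), sq_nonneg (x t ^ 2)]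
    have := hsm hT
    simpa [hI0] using this
  obtain ⟨s, hs⟩ := exists_abs_max_of_periodic hT hxc hxT
  have hxT0 : x T = x 0 := by simpa using hxT 0
  have hvT0 : v T = v 0 := by simpa using hvT 0
  refine exists_largest_exponent (Q := 3 * |x s| ^ 2) (β := 4 * E * T - I T)
    (u₁ := v) (v₁ := fun t => -x t - x t ^ 3)
    (u₂ := fun t => x t ^ 3 + (2 + 4 * E) * x t + (4 * E * t - I t) * v t)
    (v₂ := fun t => 3 * x t ^ 2 * v t + (2 + 4 * E) * v t + (4 * E - x t ^ 2) * v t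
      + (4 * E * t - I t) * (-x t - x t ^ 3)) (by fun_prop) (fun t => ?_)
    (fun t => by rw [hxT]) hT (fun t => ?_) (fun t => ?_) hvT0 (by simp only [hxT0]) ?_ ?_ hβ ?_ ?_
  · rw [abs_mul, abs_pow, abs_of_pos (by norm_num : (0 : ℝ) < 3)]
    exact mul_le_mul_of_nonneg_left (pow_le_pow_left₀ (abs_nonneg _) (hs t) 2) (by norm_num)
  · refine ⟨hv t, ((hx t).neg.sub ((hx t).pow 3)).congr_deriv ?_⟩
    simp only [Pi.zero_apply]
    push_cast
    ring
  · constructor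
    · refine ((((hx t).pow 3).add ((hx t).const_mul (2 + 4 * E))).add
        ((hmd t).mul (hv t))).congr_deriv ?_
      push_cast
      ring
    · have e1 := (((hx t).pow 2).const_mul 3).mul (hv t)
      have e2 := (hv t).const_mul (2 + 4 * E)
      have e3 := (((hx t).pow 2).const_sub (4 * E)).mul (hv t)
      have e4 := (hmd t).mul ((hx t).neg.sub ((hx t).pow 3))
      refine (((e1.add e2).add e3).add e4).congr_deriv ?_
      simp only [Pi.zero_apply, Pi.pow_apply, Pi.neg_apply, Pi.sub_apply]
      push_cast
      linear_combination (8 * x t) * hE t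
  · simp only [hxT0, hvT0, hI0]
    ring
  · simp only [hxT0, hvT0, hI0]
    ring
  · simp only [hI0]
    have hpos : 0 < v 0 ^ 2 + x 0 ^ 2 := by
      by_contra! hcon
      have hx0 : x 0 ^ 2 = 0 := by nlinarith [sq_nonneg (v 0), sq_nonneg (x 0)]
      have hv0 : v 0 ^ 2 = 0 := by nlinarith [sq_nonneg (v 0), sq_nonneg (x 0)]
      rw [hEdef, hv0, hx0, show x 0 ^ 4 = (x 0 ^ 2) ^ 2 by ring, hx0] at hE0
      norm_num at hE0
    calc 0 < 2 * (v 0 ^ 2 + x 0 ^ 2) := by positivity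
      _ ≤ 2 * (v 0 ^ 2 + x 0 ^ 2) + (v 0 ^ 2 * (2 * x 0 ^ 2 + 8 * E)
          + x 0 ^ 2 * (x 0 ^ 4 + 3 * x 0 ^ 2 + 4 * E * x 0 ^ 2 + 4 * E)) := by
        have : 0 ≤ v 0 ^ 2 * (2 * x 0 ^ 2 + 8 * E)
          + x 0 ^ 2 * (x 0 ^ 4 + 3 * x 0 ^ 2 + 4 * E * x 0 ^ 2 + 4 * E) := by positivity
        linarith
      _ = _ := by ring
  · by_contra! hcon
    have hm : T / 2 ∈ Set.Ioo 0 T := ⟨by linarith, by linarith⟩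
    have h0 : v =ᶠ[𝓝 (T / 2)] fun _ => 0 := by
      filter_upwards [isOpen_Ioo.mem_nhds hm] with t ht using hcon t (Set.Ioo_subset_Icc_self ht)
    have h1 := (hv (T / 2)).unique ((hasDerivAt_const (T / 2) (0 : ℝ)).congr_of_eventuallyEq h0)
    have h2 : x (T / 2) = 0 := by
      have : x (T / 2) * (1 + x (T / 2) ^ 2) = 0 := by linarith
      rcases mul_eq_zero.1 this with h | h
      · exact h
      · nlinarith [sq_nonneg (x (T / 2))]
    have h3 := hE (T / 2)
    rw [h0.self_of_nhds, h2] at h3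
    norm_num at h3
    linarith

/-- Coefficients of the square of a formal power series. -/
def sqCoeff (w : ℕ → ℝ) (k : ℕ) : ℝ := ∑ p ∈ Finset.HasAntidiagonal.antidiagonal k, w p.1 * w p.2

/-- Coefficients of the cube of a formal power series. -/
def cubeCoeff (w : ℕ → ℝ) (k : ℕ) : ℝ := ∑ p ∈ Finset.HasAntidiagonal.antidiagonal k, w p.1 * sqCoeff w p.2

lemma sqCoeff_congr {w w' : ℕ → ℝ} {k : ℕ} (h0 : w 0 = 0) (h0' : w' 0 = 0)
    (h : ∀ i < k, w i = w' i) : sqCoeff w k = sqCoeff w' k := by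
  refine Finset.sum_congr rfl fun p hp => ?_
  rw [Finset.HasAntidiagonal.mem_antidiagonal] at hp
  rcases Nat.eq_zero_or_pos p.1 with h1 | h1
  · rw [h1, h0, h0', zero_mul, zero_mul]
  rcases Nat.eq_zero_or_pos p.2 with h2 | h2
  · rw [h2, h0, h0', mul_zero, mul_zero]
  rw [h _ (by omega), h _ (by omega)]

lemma cubeCoeff_congr {w w' : ℕ → ℝ} {k : ℕ} (h0 : w 0 = 0) (h0' : w' 0 = 0)
    (h : ∀ i < k, w i = w' i) : cubeCoeff w k = cubeCoeff w' k := by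
  refine Finset.sum_congr rfl fun p hp => ?_
  rw [Finset.HasAntidiagonal.mem_antidiagonal] at hp
  rcases Nat.eq_zero_or_pos p.1 with h1 | h1
  · rw [h1, h0, h0', zero_mul, zero_mul]
  rw [sqCoeff_congr h0 h0' fun i hi => h i (by omega)]
  rcases Nat.eq_zero_or_pos p.2 with h2 | h2
  · rw [h2, sqCoeff, Finset.Nat.antidiagonal_zero, Finset.sum_singleton, h0', mul_zero, mul_zero,
      mul_zero]
  rw [h _ (by omega)]

lemma abs_sqCoeff_le {w : ℕ → ℝ} {η r : ℝ} (h : ∀ i, |w i| ≤ η * r ^ i) (k : ℕ) :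
    |sqCoeff w k| ≤ (k + 1) * η ^ 2 * r ^ k := by
  refine (Finset.abs_sum_le_sum_abs _ _).trans ?_
  have : ∀ p ∈ Finset.HasAntidiagonal.antidiagonal k, |w p.1 * w p.2| ≤ η ^ 2 * r ^ k := fun p hp => by
    rw [abs_mul, ← Finset.HasAntidiagonal.mem_antidiagonal.1 hp, pow_add]
    calc |w p.1| * |w p.2| ≤ (η * r ^ p.1) * (η * r ^ p.2) :=
          mul_le_mul (h _) (h _) (abs_nonneg _) ((abs_nonneg _).trans (h _))
      _ = _ := by ring
  refine (Finset.sum_le_card_nsmul _ _ _ this).trans (le_of_eq ?_)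
  rw [Finset.Nat.card_antidiagonal, nsmul_eq_mul]
  push_cast
  ring

lemma abs_cubeCoeff_le {w : ℕ → ℝ} {η r : ℝ} (hη : 0 ≤ η) (hr : 0 ≤ r)
    (h : ∀ i, |w i| ≤ η * r ^ i) (k : ℕ) :
    |cubeCoeff w k| ≤ (k + 1) ^ 2 * η ^ 3 * r ^ k := by
  refine (Finset.abs_sum_le_sum_abs _ _).trans ?_
  have : ∀ p ∈ Finset.HasAntidiagonal.antidiagonal k, |w p.1 * sqCoeff w p.2| ≤ (k + 1) * η ^ 3 * r ^ k := by
    intro p hp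
    have hpk := Finset.HasAntidiagonal.mem_antidiagonal.1 hp
    have hle : (p.2 : ℝ) ≤ k := by exact_mod_cast (by omega : p.2 ≤ k)
    rw [abs_mul]
    calc |w p.1| * |sqCoeff w p.2| ≤ (η * r ^ p.1) * ((p.2 + 1) * η ^ 2 * r ^ p.2) :=
          mul_le_mul (h _) (abs_sqCoeff_le h _) (abs_nonneg _) ((abs_nonneg _).trans (h _))
      _ = (p.2 + 1) * η ^ 3 * r ^ k := by rw [← hpk, pow_add]; ring
      _ ≤ _ := by gcongr
  refine (Finset.sum_le_card_nsmul _ _ _ this).trans (le_of_eq ?_)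
  rw [Finset.Nat.card_antidiagonal, nsmul_eq_mul]
  push_cast
  ring

lemma sqCoeff_scale (c : ℝ) (w : ℕ → ℝ) (k : ℕ) :
    sqCoeff (fun i => c ^ i * w i) k = c ^ k * sqCoeff w k := by
  rw [sqCoeff, sqCoeff, Finset.mul_sum]
  refine Finset.sum_congr rfl fun p hp => ?_
  rw [← Finset.HasAntidiagonal.mem_antidiagonal.1 hp, pow_add]
  ring

lemma cubeCoeff_scale (c : ℝ) (w : ℕ → ℝ) (k : ℕ) :
    cubeCoeff (fun i => c ^ i * w i) k = c ^ k * cubeCoeff w k := by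
  rw [cubeCoeff, cubeCoeff, Finset.mul_sum]
  refine Finset.sum_congr rfl fun p hp => ?_
  rw [sqCoeff_scale, ← Finset.HasAntidiagonal.mem_antidiagonal.1 hp, pow_add]
  ring

lemma hasSum_sqCoeff {z : ℕ → ℝ} (hz : Summable fun k => ‖z k‖) :
    Summable (fun k => ‖sqCoeff z k‖) ∧ HasSum (sqCoeff z) ((∑' k, z k) ^ 2) := by
  have h1 := summable_norm_sum_mul_antidiagonal_of_summable_norm hz hz
  refine ⟨h1, ?_⟩
  rw [sq, tsum_mul_tsum_eq_tsum_sum_antidiagonal_of_summable_norm hz hz]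
  exact h1.of_norm.hasSum

lemma hasSum_cubeCoeff {z : ℕ → ℝ} (hz : Summable fun k => ‖z k‖) :
    HasSum (cubeCoeff z) ((∑' k, z k) ^ 3) := by
  have h1 := summable_norm_sum_mul_antidiagonal_of_summable_norm hz (hasSum_sqCoeff hz).1
  rw [pow_succ', ← (hasSum_sqCoeff hz).2.tsum_eq,
    tsum_mul_tsum_eq_tsum_sum_antidiagonal_of_summable_norm hz (hasSum_sqCoeff hz).1]
  exact h1.of_norm.hasSum

/-- The forcing of the `k`-th coefficient in the expansion of the unstable manifold. -/
def manifoldForcing (x : ℝ → ℝ) (w : ℕ → ℝ → ℝ) (k : ℕ) (t : ℝ) : ℝ :=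
  -(3 * x t * sqCoeff (fun i => w i t) k + cubeCoeff (fun i => w i t) k)

lemma manifoldForcing_congr {x : ℝ → ℝ} {w w' : ℕ → ℝ → ℝ} {k : ℕ} (h0 : w 0 = 0) (h0' : w' 0 = 0)
    (h : ∀ i < k, w i = w' i) : manifoldForcing x w k = manifoldForcing x w' k := by
  funext t
  rw [manifoldForcing, manifoldForcing,
    sqCoeff_congr (congrFun h0 t) (congrFun h0' t) fun i hi => congrFun (h i hi) t,
    cubeCoeff_congr (congrFun h0 t) (congrFun h0' t) fun i hi => congrFun (h i hi) t]

lemma continuous_manifoldForcing {x : ℝ → ℝ} {w : ℕ → ℝ → ℝ} (hx : Continuous x)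
    (hw : ∀ i, Continuous (w i)) (k : ℕ) : Continuous (manifoldForcing x w k) := by
  have h2 : ∀ k, Continuous fun t => sqCoeff (fun i => w i t) k := fun k =>
    continuous_finsetSum _ fun p _ => (hw _).mul (hw _)
  have h3 : Continuous fun t => cubeCoeff (fun i => w i t) k :=
    continuous_finsetSum _ fun p _ => (hw _).mul (h2 _)
  have := h2 k
  unfold manifoldForcing
  fun_prop

lemma abs_manifoldForcing_le {x : ℝ → ℝ} {w : ℕ → ℝ → ℝ} {η r X t : ℝ} (hη : 0 ≤ η) (hη1 : η ≤ 1)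
    (hr : 0 ≤ r) (hX : |x t| ≤ X) (h : ∀ i, |w i t| ≤ η * r ^ i) (k : ℕ) :
    |manifoldForcing x w k t| ≤ (3 * X + 1) * (k + 1) ^ 2 * η ^ 2 * r ^ k := by
  have hX0 := (abs_nonneg _).trans hX
  have hk : (0 : ℝ) ≤ k := k.cast_nonneg
  rw [manifoldForcing, abs_neg]
  refine (abs_add_le _ _).trans ?_
  have h2 : |3 * x t * sqCoeff (fun i => w i t) k| ≤ 3 * X * ((k + 1) ^ 2 * η ^ 2 * r ^ k) := by
    rw [abs_mul, abs_mul, abs_of_pos (by norm_num : (0 : ℝ) < 3)]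
    have := abs_sqCoeff_le (w := fun i => w i t) h k
    have h1 : ((k : ℝ) + 1) * η ^ 2 * r ^ k ≤ (k + 1) ^ 2 * η ^ 2 * r ^ k := by
      gcongr
      nlinarith
    gcongr
    exact this.trans h1
  have h3 : |cubeCoeff (fun i => w i t) k| ≤ (k + 1) ^ 2 * η ^ 2 * r ^ k := by
    refine (abs_cubeCoeff_le hη hr h k).trans ?_
    have := pow_le_pow_of_le_one hη hη1 (by norm_num : 2 ≤ 3)
    gcongr
  linarith

lemma exists_strong_rec {α : Type*} (z : α) (step : ℕ → (ℕ → α) → α) :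
    ∃ W : ℕ → α, ∀ k, W k = step k fun i => if i < k then W i else z := by
  classical
  refine ⟨fun k => Nat.strongRec (motive := fun _ => α)
    (fun k ih => step k fun i => if h : i < k then ih i h else z) k, fun k => ?_⟩
  beta_reduce
  rw [Nat.strongRec_eq]
  simp

/-- Formal expansion of the unstable manifold in powers of `exp (lam t)`. -/
lemma exists_manifold_coeffs {x w₁ g₁ : ℝ → ℝ} {T lam : ℝ} (hxc : Continuous x)
    (hxT : ∀ t, x (t + T) = x t) (hlam : 0 < lam)
    (h₁ : PeriodicSol T (fun t => 3 * x t ^ 2) lam 0 w₁ g₁)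
    (hres : ∀ a > lam, ∀ F : ℝ → ℝ, Continuous F → (∀ t, F (t + T) = F t) →
        ∃ w g, PeriodicSol T (fun t => 3 * x t ^ 2) a F w g) :
    ∃ w g : ℕ → ℝ → ℝ, w 0 = 0 ∧ g 0 = 0 ∧ w 1 = w₁ ∧
      ∀ k : ℕ, PeriodicSol T (fun t => 3 * x t ^ 2) (k * lam) (manifoldForcing x w k) (w k) (g k) := by
  classical
  obtain ⟨W, hW⟩ := exists_strong_rec (0 : ℝ → ℝ) fun k U =>
    if k = 0 then 0 else if k = 1 then w₁ else
      if h : ∃ w g, PeriodicSol T (fun t => 3 * x t ^ 2) (k * lam) (manifoldForcing x U k) w g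
      then h.choose else 0
  have hW0 : W 0 = 0 := by rw [hW]; simp
  have hW1 : W 1 = w₁ := by rw [hW]; simp
  have hz : PeriodicSol T (fun t => 3 * x t ^ 2) ((0 : ℕ) * lam) (manifoldForcing x W 0) 0 0 := by
    have : manifoldForcing x W 0 = 0 := by
      funext t; simp [manifoldForcing, sqCoeff, cubeCoeff, hW0]
    rw [this]
    refine ⟨by simp, by simp, fun t => ?_, fun t => ?_⟩
    · simp
    · simp
  have hmain : ∀ k : ℕ, ∃ g, PeriodicSol T (fun t => 3 * x t ^ 2) (k * lam)
      (manifoldForcing x W k) (W k) g := by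
    intro k
    induction k using Nat.strong_induction_on with
    | _ k ih =>
    rcases Nat.lt_or_ge k 2 with hk | hk
    · interval_cases k
      · exact ⟨0, by rw [hW0]; exact hz⟩
      · refine ⟨g₁, ?_⟩
        have : manifoldForcing x W 1 = 0 := by
          funext t
          simp [manifoldForcing, sqCoeff, cubeCoeff, hW0, Finset.Nat.antidiagonal_succ]
        rw [this, hW1]
        simpa using h₁
    · set U : ℕ → ℝ → ℝ := fun i => if i < k then W i else 0 with hU
      have hU0 : U 0 = 0 := by simp [hU, hW0]
      have hcongr : manifoldForcing x U k = manifoldForcing x W k :=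
        manifoldForcing_congr hU0 hW0 fun i hi => by simp [hU, hi]
      have hUc : ∀ i, Continuous (U i) := by
        intro i
        by_cases hi : i < k
        · obtain ⟨g, hg⟩ := ih i hi
          simpa [hU, hi] using hg.continuous_w
        · simpa [hU, hi] using (continuous_zero : Continuous (0 : ℝ → ℝ))
      have hUT : ∀ i t, U i (t + T) = U i t := by
        intro i t
        by_cases hi : i < k
        · obtain ⟨g, hg⟩ := ih i hi
          simpa [hU, hi] using hg.periodic_w t
        · simp [hU, hi]
      have hk1 : lam < k * lam := by
        have : (2 : ℝ) ≤ k := by exact_mod_cast hk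
        nlinarith
      have hex := hres _ hk1 (manifoldForcing x U k) (continuous_manifoldForcing hxc hUc k)
        (fun t => by simp only [manifoldForcing, hxT, hUT])
      have hWk : W k = hex.choose := by
        rw [hW, if_neg (by omega), if_neg (by omega), dif_pos hex]
      rw [hWk, ← hcongr]
      exact hex.choose_spec
  choose g hg using hmain
  refine ⟨W, fun k => if k = 0 then 0 else g k, hW0, by simp, hW1, fun k => ?_⟩
  rcases Nat.eq_zero_or_pos k with rfl | hk
  · simpa [hW0] using hz
  · simpa [hk.ne'] using hg k

/-- Majorant of the unstable manifold expansion by a geometric series. -/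
lemma manifold_coeffs_geometric {x : ℝ → ℝ} {w g : ℕ → ℝ → ℝ} {T lam X : ℝ} (hT : 0 < T)
    (hlam : 0 < lam) (hX : ∀ t, |x t| ≤ X) (hw0 : w 0 = 0)
    (h : ∀ k : ℕ, PeriodicSol T (fun t => 3 * x t ^ 2) (k * lam) (manifoldForcing x w k)
      (w k) (g k)) :
    ∃ η r : ℝ, 0 < η ∧ η ≤ 1 ∧ 1 ≤ r ∧ ∀ k t, |w k t| ≤ η * r ^ k := by
  have hX0 : 0 ≤ X := (abs_nonneg _).trans (hX 0)
  set Q := 3 * X ^ 2 with hQdef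
  have hQ : ∀ t, |3 * x t ^ 2| ≤ Q := fun t => by
    rw [abs_mul, abs_pow, abs_of_pos (by norm_num : (0 : ℝ) < 3), hQdef]
    gcongr
    exact hX t
  set η := min 1 (lam ^ 2 / (8 * (3 * X + 1))) with hηdef
  have hη : 0 < η := lt_min one_pos (by positivity)
  have hη1 : η ≤ 1 := min_le_left _ _
  have hη2 : 8 * (3 * X + 1) * η ≤ lam ^ 2 := by
    have : η ≤ lam ^ 2 / (8 * (3 * X + 1)) := min_le_right _ _
    rwa [le_div_iff₀ (by positivity), mul_comm] at this
  obtain ⟨k₀, hk₀⟩ := exists_nat_gt (max 1 (2 * (1 + Q)) / lam)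
  have hk₁ : ∀ k : ℕ, k₀ ≤ k → 2 * (1 + Q) ≤ (k * lam) ^ 2 := fun k hk => by
    have h1 : max 1 (2 * (1 + Q)) < k * lam := by
      rw [div_lt_iff₀ hlam] at hk₀
      have : (k₀ : ℝ) ≤ k := by exact_mod_cast hk
      nlinarith
    have h2 := le_max_left 1 (2 * (1 + Q))
    have h3 := le_max_right 1 (2 * (1 + Q))
    nlinarith
  have hk₀pos : 0 < k₀ := by
    have : 0 < max 1 (2 * (1 + Q)) / lam := div_pos (lt_max_of_lt_left one_pos) hlam
    exact_mod_cast this.trans hk₀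
  choose s hs using fun k => exists_abs_max_of_periodic hT (h k).continuous_w (h k).periodic_w
  set r := 1 + ∑ i ∈ Finset.range k₀, |w i (s i)| / η with hr
  have hr1 : 1 ≤ r := by
    have : 0 ≤ ∑ i ∈ Finset.range k₀, |w i (s i)| / η :=
      Finset.sum_nonneg fun i _ => by positivity
    linarith
  refine ⟨η, r, hη, hη1, hr1, fun k => ?_⟩
  induction k using Nat.strong_induction_on with
  | _ k ih =>
  intro t
  rcases Nat.eq_zero_or_pos k with rfl | hkpos
  · simpa [hw0] using hη.le
  rcases Nat.lt_or_ge k k₀ with hk | hk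
  · have h1 : |w k (s k)| / η ≤ r := by
      have := Finset.single_le_sum (f := fun i => |w i (s i)| / η) (fun i _ => by positivity)
        (Finset.mem_range.2 hk)
      linarith
    rw [div_le_iff₀ hη] at h1
    calc |w k t| ≤ |w k (s k)| := hs k t
      _ ≤ η * r := by linarith
      _ ≤ η * r ^ k := by
        gcongr
        exact le_self_pow₀ hr1 hkpos.ne'
  · set U : ℕ → ℝ → ℝ := fun i => if i < k then w i else 0 with hU
    have hcongr : manifoldForcing x U k = manifoldForcing x w k :=
      manifoldForcing_congr (by simp [hU, hw0]) hw0 fun i hi => by simp [hU, hi]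
    have hUb : ∀ t i, |U i t| ≤ η * r ^ i := fun t i => by
      by_cases hi : i < k
      · simpa [hU, hi] using ih i hi t
      · simp only [hU, hi, if_false, Pi.zero_apply, abs_zero]
        positivity
    have hF : ∀ t, |manifoldForcing x w k t| ≤ (3 * X + 1) * (k + 1) ^ 2 * η ^ 2 * r ^ k :=
      fun t => by
        rw [← hcongr]
        exact abs_manifoldForcing_le hη.le hη1 (by linarith) (hX t) (hUb t) k
    have hk1 : (1 : ℝ) ≤ k := by exact_mod_cast hkpos
    have hkl : 0 < k * lam := by positivity
    refine ((h k).abs_w_le hkl hT hQ hF (hk₁ k hk) t).trans ?_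
    rw [div_le_iff₀ (by positivity)]
    have h4 : ((k : ℝ) + 1) ^ 2 ≤ 4 * k ^ 2 := by nlinarith
    calc 2 * ((3 * X + 1) * (k + 1) ^ 2 * η ^ 2 * r ^ k)
        ≤ 2 * ((3 * X + 1) * (4 * k ^ 2) * η ^ 2 * r ^ k) := by gcongr
      _ = (8 * (3 * X + 1) * η) * (η * r ^ k * k ^ 2) := by ring
      _ ≤ lam ^ 2 * (η * r ^ k * k ^ 2) := by gcongr
      _ = η * r ^ k * (k * lam) ^ 2 := by ring

lemma manifold_coeffs_bounds {x : ℝ → ℝ} {w g : ℕ → ℝ → ℝ} {T lam X : ℝ} (hT : 0 < T)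
    (hlam : 0 < lam) (hX : ∀ t, |x t| ≤ X) (hw0 : w 0 = 0) (hg0 : g 0 = 0)
    (h : ∀ k : ℕ, PeriodicSol T (fun t => 3 * x t ^ 2) (k * lam) (manifoldForcing x w k)
      (w k) (g k)) :
    ∃ r C : ℝ, 1 ≤ r ∧ ∀ k t, |w k t| ≤ r ^ k ∧ |g k t| ≤ C * (k + 1) ^ 2 * r ^ k ∧
      |manifoldForcing x w k t - (Real.exp (-(k * lam * T)) + 3 * x t ^ 2) * w k t|
        ≤ C * (k + 1) ^ 2 * r ^ k := by
  obtain ⟨η, r, hη, hη1, hr1, hb⟩ := manifold_coeffs_geometric hT hlam hX hw0 h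
  have hX0 : 0 ≤ X := (abs_nonneg _).trans (hX 0)
  set Q := 3 * X ^ 2 with hQdef
  have hQ : ∀ t, |3 * x t ^ 2| ≤ Q := fun t => by
    rw [abs_mul, abs_pow, abs_of_pos (by norm_num : (0 : ℝ) < 3), hQdef]
    gcongr
    exact hX t
  have hb1 : ∀ k t, |w k t| ≤ r ^ k := fun k t =>
    (hb k t).trans (mul_le_of_le_one_left (by positivity) hη1)
  set D := 3 * X + 2 + Q with hD
  have hD0 : 0 ≤ D := by positivity
  refine ⟨r, D * (1 + 1 / lam), hr1, fun k t => ⟨hb1 k t, ?_⟩⟩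
  rcases Nat.eq_zero_or_pos k with rfl | hkpos
  · have h1 : manifoldForcing x w 0 t = 0 := by
      simp [manifoldForcing, sqCoeff, cubeCoeff, hw0]
    rw [h1, hw0, hg0]
    simp only [Pi.zero_apply, mul_zero, sub_zero, abs_zero]
    constructor <;> positivity
  have hk1 : (1 : ℝ) ≤ k := by exact_mod_cast hkpos
  have hkl : 0 < k * lam := by positivity
  have hF : ∀ t, |manifoldForcing x w k t| ≤ (3 * X + 1) * (k + 1) ^ 2 * r ^ k := fun t => by
    simpa using abs_manifoldForcing_le zero_le_one le_rfl (zero_le_one.trans hr1) (hX t)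
      (fun i => by simpa using hb1 i t) k
  have hM : (3 * X + 1) * (k + 1) ^ 2 * r ^ k + (1 + Q) * r ^ k ≤ D * ((k + 1) ^ 2 * r ^ k) := by
    have : r ^ k ≤ (k + 1) ^ 2 * r ^ k := le_mul_of_one_le_left (by positivity) (by nlinarith)
    have hQ0 : 0 ≤ 1 + Q := by positivity
    have := mul_le_mul_of_nonneg_left this hQ0
    rw [hD]
    linarith
  have hP : 0 ≤ D * ((k + 1) ^ 2 * r ^ k) := by positivity
  constructor
  · refine ((h k).abs_g_le hkl hT hQ hF (hb1 k) t).trans ?_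
    calc _ ≤ D * ((k + 1) ^ 2 * r ^ k) / (k * lam) := by gcongr
      _ ≤ D * ((k + 1) ^ 2 * r ^ k) / lam := by
        gcongr
        nlinarith
      _ ≤ D * ((k + 1) ^ 2 * r ^ k) / lam + D * ((k + 1) ^ 2 * r ^ k) := by linarith
      _ = _ := by ring
  · refine (PeriodicSol.abs_rhs_le hkl hT hQ hF (hb1 k) t).trans (hM.trans ?_)
    have : 0 ≤ D * ((k + 1) ^ 2 * r ^ k) / lam := by positivity
    calc _ ≤ D * ((k + 1) ^ 2 * r ^ k) / lam + D * ((k + 1) ^ 2 * r ^ k) := by linarith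
      _ = _ := by ring

lemma exists_exp_mul_le_half {lam r : ℝ} (hlam : 0 < lam) (hr : 1 ≤ r) :
    ∃ t₀ : ℝ, ∀ t < t₀, r * Real.exp (lam * t) ≤ 1 / 2 := by
  have hr0 : 0 < r := one_pos.trans_le hr
  refine ⟨Real.log (1 / (2 * r)) / lam, fun t ht => ?_⟩
  rw [lt_div_iff₀ hlam] at ht
  have := Real.exp_lt_exp.2 ht
  rw [Real.exp_log (by positivity), lt_div_iff₀ (by positivity), mul_comm t] at this
  linarith

lemma norm_exp_mul_le {a : ℕ → ℝ → ℝ} {lam r C t : ℝ} (hr : 1 ≤ r)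
    (ha : ∀ k t, |a k t| ≤ C * (k + 1) ^ 2 * r ^ k)
    (ht : r * Real.exp (lam * t) ≤ 1 / 2) (k : ℕ) :
    ‖Real.exp (k * lam * t) * a k t‖ ≤ C * ((k + 1) ^ 2 * (1 / 2) ^ k) := by
  have hC : 0 ≤ C := by
    have := (abs_nonneg _).trans (ha 0 0)
    simpa using this
  rw [norm_mul, Real.norm_eq_abs, Real.norm_eq_abs, Real.abs_exp, mul_assoc, Real.exp_nat_mul]
  calc Real.exp (lam * t) ^ k * |a k t| ≤ Real.exp (lam * t) ^ k * (C * (k + 1) ^ 2 * r ^ k) := by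
        gcongr
        exact ha k t
    _ = C * (k + 1) ^ 2 * (r * Real.exp (lam * t)) ^ k := by ring
    _ ≤ C * (k + 1) ^ 2 * (1 / 2) ^ k := by gcongr
    _ = _ := by ring

lemma summable_sq_mul_half_pow (C : ℝ) :
    Summable fun k : ℕ => C * (((k : ℝ) + 1) ^ 2 * (1 / 2) ^ k) := by
  have h (j : ℕ) : Summable fun k : ℕ => (k : ℝ) ^ j * (1 / 2 : ℝ) ^ k :=
    summable_pow_mul_geometric_of_norm_lt_one j (by norm_num)
  refine Summable.mul_left C (((h 2).add (((h 1).mul_left 2).add (h 0))).congr fun k => ?_)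
  ring

lemma tendsto_tsum_exp_mul {a : ℕ → ℝ → ℝ} {lam r C : ℝ} (hlam : 0 < lam) (hr : 1 ≤ r)
    (ha : ∀ k t, |a k t| ≤ C * (k + 1) ^ 2 * r ^ k) (ha0 : a 0 = 0) :
    Tendsto (fun t => ∑' k : ℕ, Real.exp (k * lam * t) * a k t) atBot (𝓝 0) := by
  obtain ⟨t₀, ht₀⟩ := exists_exp_mul_le_half hlam hr
  have h := tendsto_tsum_of_dominated_convergence (𝓕 := atBot)
    (f := fun t (k : ℕ) => Real.exp (k * lam * t) * a k t) (g := fun _ => 0)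
    (summable_sq_mul_half_pow C) (fun k => ?_) ?_
  · simpa using h
  · rcases Nat.eq_zero_or_pos k with rfl | hk
    · simp [ha0]
    have hk1 : (0 : ℝ) < k := by exact_mod_cast hk
    have h1 : Tendsto (fun t => Real.exp (k * lam * t)) atBot (𝓝 0) :=
      Real.tendsto_exp_atBot.comp (tendsto_id.const_mul_atBot (by positivity))
    refine squeeze_zero_norm (fun t => ?_) (by simpa using h1.mul_const (C * (k + 1) ^ 2 * r ^ k))
    rw [norm_mul, Real.norm_eq_abs, Real.norm_eq_abs, Real.abs_exp]
    gcongr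
    exact ha k t
  · filter_upwards [eventually_lt_atBot t₀] with t ht k
    exact norm_exp_mul_le hr ha (ht₀ t ht) k

lemma hasDerivAt_tsum_exp_mul {a b : ℕ → ℝ → ℝ} {lam r C t₀ : ℝ} (hr : 1 ≤ r)
    (ht₀ : ∀ t < t₀, r * Real.exp (lam * t) ≤ 1 / 2)
    (ha : ∀ k t, |a k t| ≤ C * (k + 1) ^ 2 * r ^ k)
    (hb : ∀ k t, |b k t| ≤ C * (k + 1) ^ 2 * r ^ k)
    (hab : ∀ k t, HasDerivAt (a k) (b k t - k * lam * a k t) t) {t : ℝ} (ht : t < t₀) :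
    HasDerivAt (fun t => ∑' k : ℕ, Real.exp (k * lam * t) * a k t)
      (∑' k : ℕ, Real.exp (k * lam * t) * b k t) t := by
  refine hasDerivAt_tsum_of_isPreconnected (t := Set.Iio t₀) (y₀ := t)
    (g' := fun (k : ℕ) t => Real.exp (k * lam * t) * b k t) (summable_sq_mul_half_pow C)
    isOpen_Iio isPreconnected_Iio (fun k s _ => ?_)
    (fun k s hs => norm_exp_mul_le hr hb (ht₀ s hs) k) ht ?_ ht
  · have h1 : HasDerivAt (fun t => Real.exp (k * lam * t))
        (Real.exp (k * lam * s) * (k * lam)) s := by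
      simpa using ((hasDerivAt_id s).const_mul (k * lam)).exp
    refine (h1.mul (hab k s)).congr_deriv ?_
    ring
  · exact (summable_sq_mul_half_pow C).of_norm_bounded
      (fun k => norm_exp_mul_le hr ha (ht₀ t ht) k)

lemma abs_first_coeff_le {z : ℕ → ℝ} {ρ : ℝ} (hρ0 : 0 ≤ ρ) (hρ : ρ ≤ 1 / 2)
    (hz : ∀ k, |z k| ≤ ρ ^ k) (hz0 : z 0 = 0) (hsum : ∑' k, z k = 0) : |z 1| ≤ 2 * ρ ^ 2 := by
  have hg := hasSum_geometric_of_lt_one hρ0 (by linarith : ρ < 1)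
  have hs : Summable z := hg.summable.of_norm_bounded hz
  have h1 := hs.sum_add_tsum_nat_add 2
  rw [hsum, Finset.sum_range_succ, Finset.sum_range_one, hz0, zero_add] at h1
  have h2 : ‖∑' k, z (k + 2)‖ ≤ ρ ^ 2 * (1 - ρ)⁻¹ :=
    tsum_of_norm_bounded (hg.mul_left (ρ ^ 2)) fun k => by
      rw [← pow_add, add_comm 2 k]
      exact hz _
  rw [eq_neg_of_add_eq_zero_left h1, abs_neg]
  refine h2.trans ?_
  have : (1 - ρ)⁻¹ ≤ 2 := by
    rw [inv_le_comm₀ (by linarith) (by norm_num)]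
    linarith
  nlinarith [sq_nonneg ρ]

lemma eq_zero_of_periodic_of_tendsto_zero {w : ℝ → ℝ} {T : ℝ} (hT : 0 < T)
    (hw : ∀ t, w (t + T) = w t) (h : Tendsto w atBot (𝓝 0)) (t : ℝ) : w t = 0 := by
  have h1 : ∀ n : ℕ, w (t - n * T) = w t := fun n => by
    induction n with
    | zero => simp
    | succ n ih =>
      rw [← ih, ← hw]
      congr 1
      push_cast
      ring
  have h2 : Tendsto (fun n : ℕ => t - n * T) atTop atBot :=
    tendsto_atBot_add_const_left _ _ (tendsto_neg_atTop_atBot.comp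
      (tendsto_natCast_atTop_atTop.atTop_mul_const hT))
  have h3 := h.comp h2
  simp only [Function.comp_def, h1] at h3
  exact tendsto_nhds_unique tendsto_const_nhds h3

/-- A nontrivial solution of the delayed Duffing equation near `-∞`, asymptotic to a given
`T`-periodic orbit. -/
lemma exists_unstable_solution_near_atBot {x v : ℝ → ℝ} {T : ℝ} (hT : 0 < T)
    (hx : ∀ t, HasDerivAt x (v t) t) (hv : ∀ t, HasDerivAt v (-x t - x t ^ 3) t)
    (hxT : ∀ t, x (t + T) = x t) (hvT : ∀ t, v (t + T) = v t) (hnc : ¬∃ c, ∀ t, x t = c) :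
    ∃ (t₀ : ℝ) (y u : ℝ → ℝ),
      (∀ t < t₀, HasDerivAt y (u t) t ∧ HasDerivAt u (-y (t - T) - y t ^ 3) t) ∧
      Tendsto (fun t => y t - x t) atBot (𝓝 0) ∧ Tendsto (fun t => u t - v t) atBot (𝓝 0) ∧
      ∀ s, ∃ t < s, y t ≠ x t := by
  have hxc : Continuous x := continuous_iff_continuousAt.2 fun t => (hx t).continuousAt
  obtain ⟨s, hs⟩ := exists_abs_max_of_periodic hT hxc hxT
  obtain ⟨lam, hlam, ⟨w₁, g₁, h₁, τ, hτ⟩, hres⟩ := duffing_exists_exponent hT hx hv hxT hvT hnc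
  obtain ⟨w, g, hw0, hg0, hw1, h⟩ := exists_manifold_coeffs hxc hxT hlam h₁ hres
  obtain ⟨r, C, hr, hb⟩ := manifold_coeffs_bounds hT hlam hs hw0 hg0 h
  obtain ⟨t₀, ht₀⟩ := exists_exp_mul_le_half hlam hr
  have hr0 : 0 < r := one_pos.trans_le hr
  set D := max 1 C with hD
  have hle : ∀ k : ℕ, C * ((k : ℝ) + 1) ^ 2 * r ^ k ≤ D * (k + 1) ^ 2 * r ^ k := fun k => by
    gcongr
    exact le_max_right _ _
  have hbw : ∀ k t, |w k t| ≤ D * (k + 1) ^ 2 * r ^ k := fun k t => by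
    refine (hb k t).1.trans (le_mul_of_one_le_left (by positivity) ?_)
    have : (1 : ℝ) ≤ D := le_max_left _ _
    have hk : (0 : ℝ) ≤ k := k.cast_nonneg
    nlinarith [mul_le_mul this (one_le_pow₀ (by linarith : (1 : ℝ) ≤ k + 1) (n := 2)) zero_le_one
      (by linarith)]
  have hbg : ∀ k t, |g k t| ≤ D * (k + 1) ^ 2 * r ^ k := fun k t =>
    (hb k t).2.1.trans (hle k)
  set f : ℕ → ℝ → ℝ := fun k t =>
    manifoldForcing x w k t - (Real.exp (-(k * lam * T)) + 3 * x t ^ 2) * w k t with hf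
  have hbf : ∀ k t, |f k t| ≤ D * (k + 1) ^ 2 * r ^ k := fun k t =>
    (hb k t).2.2.trans (hle k)
  set S : ℝ → ℝ := fun t => ∑' k : ℕ, Real.exp (k * lam * t) * w k t with hS
  set R : ℝ → ℝ := fun t => ∑' k : ℕ, Real.exp (k * lam * t) * g k t with hR
  have hSd : ∀ t < t₀, HasDerivAt S (R t) t := fun t ht =>
    hasDerivAt_tsum_exp_mul hr ht₀ hbw hbg (fun k t => (h k).deriv_w t) ht
  have hRd : ∀ t < t₀, HasDerivAt R (∑' k : ℕ, Real.exp (k * lam * t) * f k t) t := fun t ht =>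
    hasDerivAt_tsum_exp_mul hr ht₀ hbg hbf (fun k t => (h k).deriv_g t) ht
  have hsumm : ∀ t < t₀, Summable fun k : ℕ => ‖Real.exp (k * lam * t) * w k t‖ := fun t ht =>
    (summable_sq_mul_half_pow D).of_nonneg_of_le (fun _ => norm_nonneg _)
      (norm_exp_mul_le hr hbw (ht₀ t ht))
  have hEq : ∀ t < t₀, ∑' k : ℕ, Real.exp (k * lam * t) * f k t =
      -(3 * x t * S t ^ 2 + S t ^ 3) - S (t - T) - 3 * x t ^ 2 * S t := by
    intro t ht
    have hscale : (fun k : ℕ => Real.exp (k * lam * t) * w k t) =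
        fun k => Real.exp (lam * t) ^ k * w k t := by
      funext k
      rw [mul_assoc, Real.exp_nat_mul]
    have h2 := (hasSum_sqCoeff (hsumm t ht)).2
    have h3 := hasSum_cubeCoeff (hsumm t ht)
    have h4 := (hsumm (t - T) (by linarith)).of_norm.hasSum
    have h5 := (hsumm t ht).of_norm.hasSum
    have h6 := (((h2.mul_left (3 * x t)).add h3).neg.sub h4).sub (h5.mul_left (3 * x t ^ 2))
    refine HasSum.tsum_eq (h6.congr_fun fun k => ?_)
    rw [hscale, sqCoeff_scale (Real.exp (lam * t)) (fun k => w k t),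
      cubeCoeff_scale (Real.exp (lam * t)) (fun k => w k t)]
    have hp : w k (t - T) = w k t := by
      rw [← (h k).periodic_w (t - T), sub_add_cancel]
    have he : Real.exp (k * lam * (t - T)) =
        Real.exp (lam * t) ^ k * Real.exp (-(k * lam * T)) := by
      rw [← Real.exp_nat_mul, ← Real.exp_add]
      congr 1
      ring
    have he' : Real.exp (k * lam * t) = Real.exp (lam * t) ^ k := by
      rw [mul_assoc, Real.exp_nat_mul]
    simp only [hf, manifoldForcing]
    rw [hp, he, he']
    ring
  refine ⟨t₀, fun t => x t + S t, fun t => v t + R t, fun t ht => ⟨(hx t).add (hSd t ht), ?_⟩,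
    ?_, ?_, ?_⟩
  · have h1 := (hv t).add (hRd t ht)
    rw [hEq t ht] at h1
    refine h1.congr_deriv ?_
    beta_reduce
    rw [show x (t - T) = x t by rw [← hxT (t - T), sub_add_cancel]]
    ring
  · simpa using tendsto_tsum_exp_mul hlam hr hbw hw0
  · simpa using tendsto_tsum_exp_mul hlam hr hbg hg0
  · by_contra! hcon
    obtain ⟨s₁, hs₁⟩ := hcon
    refine hτ (eq_zero_of_periodic_of_tendsto_zero hT h₁.periodic_w ?_ τ)
    have hexp : Tendsto (fun t => Real.exp (lam * t)) atBot (𝓝 0) :=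
      Real.tendsto_exp_atBot.comp (tendsto_id.const_mul_atBot hlam)
    refine squeeze_zero_norm' (a := fun t => 2 * r ^ 2 * Real.exp (lam * t)) ?_
      (by simpa using hexp.const_mul (2 * r ^ 2))
    filter_upwards [eventually_lt_atBot s₁, eventually_lt_atBot t₀] with t ht ht'
    have h0 : S t = 0 := by simpa using hs₁ t ht
    have h1 := abs_first_coeff_le (z := fun k => Real.exp (k * lam * t) * w k t)
      (ρ := r * Real.exp (lam * t)) (by positivity) (ht₀ t ht') (fun k => ?_) (by simp [hw0]) h0
    · simp only [Nat.cast_one, one_mul, hw1, abs_mul, Real.abs_exp] at h1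
      have hpos := Real.exp_pos (lam * t)
      rw [Real.norm_eq_abs]
      refine le_of_mul_le_mul_left (h1.trans (le_of_eq ?_)) hpos
      ring
    · rw [abs_mul, Real.abs_exp, mul_assoc, Real.exp_nat_mul, mul_pow, mul_comm]
      gcongr
      exact (hb k t).1

lemma lipschitzWith_clamp_pow_three {R : ℝ} (hR : 0 ≤ R) :
    LipschitzWith (Real.toNNReal (3 * R ^ 2)) fun y : ℝ => (max (-R) (min y R)) ^ 3 := by
  refine LipschitzWith.of_dist_le_mul fun y z => ?_
  rw [Real.dist_eq, Real.dist_eq, Real.coe_toNNReal _ (by positivity)]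
  have hb : ∀ y : ℝ, |max (-R) (min y R)| ≤ R := fun y =>
    abs_le.2 ⟨le_max_left _ _, max_le (by linarith) (min_le_right _ _)⟩
  have h1 : |max (-R) (min y R) - max (-R) (min z R)| ≤ |y - z| := by
    refine (abs_max_sub_max_le_max _ _ _ _).trans ?_
    rw [sub_self, abs_zero, max_eq_right (abs_nonneg _)]
    refine (abs_min_sub_min_le_max _ _ _ _).trans ?_
    rw [sub_self, abs_zero, max_eq_left (abs_nonneg _)]
  have hp := hb y
  have hq := hb z
  generalize max (-R) (min y R) = p, max (-R) (min z R) = q at *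
  have h2 : |p ^ 2 + p * q + q ^ 2| ≤ 3 * R ^ 2 := by
    rw [abs_le] at hp hq ⊢
    constructor <;> nlinarith
  calc |p ^ 3 - q ^ 3| = |p ^ 2 + p * q + q ^ 2| * |p - q| := by
        rw [← abs_mul]
        congr 1
        ring
    _ ≤ 3 * R ^ 2 * |y - z| := by gcongr

lemma exists_forced_duffing {g : ℝ → ℝ} (hg : Continuous g) (a b c : ℝ) {L : ℝ} (hL : 0 < L) :
    ∃ y v : ℝ → ℝ, y c = a ∧ v c = b ∧
      ∀ t ∈ Set.Icc c (c + L), HasDerivAt y (v t) t ∧ HasDerivAt v (-g t - y t ^ 3) t := by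
  obtain ⟨G, hG⟩ := isCompact_Icc.exists_bound_of_continuousOn (s := Set.Icc c (c + L))
    hg.continuousOn
  set V := Real.sqrt ((b ^ 2 + 2 * a ^ 4 + G ^ 2) * Real.exp L) with hV
  have hV0 : 0 ≤ V := Real.sqrt_nonneg _
  set R := |a| + V * L with hRdef
  have hR : 0 ≤ R := by positivity
  set φ : ℝ → ℝ := fun y => (max (-R) (min y R)) ^ 3 with hφ
  have hφc : Continuous φ := by fun_prop
  have hφle : ∀ y, |φ y| ≤ |y| ^ 3 := fun y => by
    rw [hφ, abs_pow]
    refine pow_le_pow_left₀ (abs_nonneg _) (abs_le.2 ⟨?_, ?_⟩) 3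
    · refine le_trans ?_ (le_max_right _ _)
      exact le_min (neg_abs_le y) (by linarith [abs_nonneg y])
    · exact max_le (by linarith [abs_nonneg y]) ((min_le_left _ _).trans (le_abs_self y))
  obtain ⟨y, v, hyc, hvc, hyv⟩ := exists_second_order_of_lipschitz
    (h := fun t y => -g t - φ y) (K := Real.toNNReal (3 * R ^ 2))
    (fun t => by
      have := (LipschitzWith.const (-g t)).sub (lipschitzWith_clamp_pow_three hR)
      simpa using this)
    (fun y => by fun_prop) c a b
  refine ⟨y, v, hyc, hvc, ?_⟩
  set Φ : ℝ → ℝ := fun y => ∫ s in (0 : ℝ)..y, φ s with hΦ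
  have hΦd : ∀ y, HasDerivAt Φ (φ y) y := fun y =>
    intervalIntegral.integral_hasDerivAt_right (hφc.intervalIntegrable _ _)
      (hφc.stronglyMeasurableAtFilter _ _) hφc.continuousAt
  have hΦ0 : ∀ y, 0 ≤ Φ y := by
    intro y
    rcases le_total 0 y with h | h
    · refine intervalIntegral.integral_nonneg h fun s hs => ?_
      exact pow_nonneg ((le_min hs.1 hR).trans (le_max_right _ _)) 3
    · rw [hΦ]
      simp only
      rw [intervalIntegral.integral_symm, ← intervalIntegral.integral_neg]
      refine intervalIntegral.integral_nonneg h fun s hs => ?_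
      rw [hφ]
      simp only
      have h1 : max (-R) (min s R) ≤ 0 := max_le (by linarith) ((min_le_left _ _).trans hs.2)
      have := Odd.pow_nonpos (n := 3) (by decide) h1
      linarith
  have hΦa : Φ a ≤ a ^ 4 := by
    have := intervalIntegral.norm_integral_le_of_norm_le_const (a := 0) (b := a) (C := |a| ^ 3)
      (f := φ) (fun s hs => (hφle s).trans (pow_le_pow_left₀ (abs_nonneg s)
        (by simpa using Set.abs_sub_left_of_mem_uIcc (Set.uIoc_subset_uIcc hs)) 3))
    refine (le_abs_self _).trans (this.trans (le_of_eq ?_))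
    rw [sub_zero, ← pow_succ]
    exact Even.pow_abs (by decide) a
  have hvb : ∀ t ∈ Set.Icc c (c + L), |v t| ≤ V := by
    set W : ℝ → ℝ := fun t => (v t ^ 2 / 2 + Φ (y t) + G ^ 2 / 2) * Real.exp (-(t - c)) with hW
    have hWd : ∀ t, HasDerivAt W ((-g t * v t - (v t ^ 2 / 2 + Φ (y t) + G ^ 2 / 2)) *
        Real.exp (-(t - c))) t := fun t => by
      have h1 := ((((hyv t).2.pow 2).div_const 2).add ((hΦd (y t)).comp t (hyv t).1)).add_const
        (G ^ 2 / 2)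
      have h2 := ((hasDerivAt_id t).sub_const c).neg.exp
      refine (h1.mul h2).congr_deriv ?_
      simp only [id, Pi.add_apply, Pi.neg_apply, Function.comp, Pi.pow_apply]
      push_cast
      ring
    have hanti : AntitoneOn W (Set.Icc c (c + L)) := by
      refine antitoneOn_of_deriv_nonpos (convex_Icc _ _)
        (fun t _ => (hWd t).continuousAt.continuousWithinAt)
        (fun t _ => (hWd t).differentiableAt.differentiableWithinAt) fun t ht => ?_
      rw [(hWd t).deriv]
      refine mul_nonpos_of_nonpos_of_nonneg ?_ (Real.exp_pos _).le
      have h1 := hG t (interior_subset ht)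
      rw [Real.norm_eq_abs] at h1
      have h2 := hΦ0 (y t)
      have h3 : g t ^ 2 ≤ G ^ 2 := sq_le_sq' (by linarith [neg_abs_le (g t)])
        (by linarith [le_abs_self (g t)])
      nlinarith [sq_nonneg (g t + v t)]
    intro t ht
    have h1 := hanti (Set.left_mem_Icc.2 (by linarith)) ht ht.1
    simp only [hW, sub_self, neg_zero, Real.exp_zero, mul_one, hyc, hvc] at h1
    have h2 : v t ^ 2 / 2 + Φ (y t) + G ^ 2 / 2 ≤
        (b ^ 2 / 2 + Φ a + G ^ 2 / 2) * Real.exp (t - c) := by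
      rw [Real.exp_neg, ← div_eq_mul_inv, div_le_iff₀ (Real.exp_pos _)] at h1
      exact h1
    have h3 : Real.exp (t - c) ≤ Real.exp L := Real.exp_le_exp.2 (by linarith [ht.2])
    refine Real.abs_le_sqrt ?_
    have h4 := hΦ0 (y t)
    calc v t ^ 2 ≤ 2 * (v t ^ 2 / 2 + Φ (y t) + G ^ 2 / 2) := by nlinarith [sq_nonneg G]
      _ ≤ 2 * ((b ^ 2 / 2 + a ^ 4 + G ^ 2 / 2) * Real.exp L) := by
        gcongr
        refine h2.trans ?_
        gcongr
      _ = _ := by ring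
  intro t ht
  have h1 : |y t - a| ≤ V * (t - c) := by
    have := (convex_Icc c (c + L)).norm_image_sub_le_of_norm_hasDerivWithin_le
      (fun s _ => (hyv s).1.hasDerivWithinAt) hvb (Set.left_mem_Icc.2 (by linarith)) ht
    rw [hyc, Real.norm_eq_abs, Real.norm_eq_abs,
      abs_of_nonneg (sub_nonneg.2 ht.1)] at this
    exact this
  have h2 : |y t| ≤ R := by
    have h3 : V * (t - c) ≤ V * L := by
      gcongr
      linarith [ht.2]
    have h4 := abs_sub_abs_le_abs_sub (y t) a
    linarith
  have h5 : φ (y t) = y t ^ 3 := by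
    rw [hφ]
    simp only
    rw [min_eq_left (abs_le.1 h2).2, max_eq_right (abs_le.1 h2).1]
  exact ⟨(hyv t).1, h5 ▸ (hyv t).2⟩

lemma hasDerivAt_ite_le {f g f' g' : ℝ → ℝ} {c t : ℝ} (h : f c = g c) (h' : f' c = g' c)
    (hf : t ≤ c → HasDerivAt f (f' t) t) (hg : c ≤ t → HasDerivAt g (g' t) t) :
    HasDerivAt (fun s => if s ≤ c then f s else g s) (if t ≤ c then f' t else g' t) t := by
  rcases lt_trichotomy t c with ht | rfl | ht
  · rw [if_pos ht.le]
    refine (hf ht.le).congr_of_eventuallyEq ?_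
    filter_upwards [Iio_mem_nhds ht] with s hs
    rw [if_pos (le_of_lt hs)]
  · rw [if_pos le_rfl, ← hasDerivWithinAt_univ, ← Set.Iic_union_Ici (a := t)]
    refine HasDerivWithinAt.union ?_ ?_
    · refine (hf le_rfl).hasDerivWithinAt.congr (fun s hs => if_pos hs) (if_pos le_rfl)
    · have h1 := hg le_rfl
      rw [← h'] at h1
      refine h1.hasDerivWithinAt.congr (fun s hs => ?_) (by rw [if_pos le_rfl, h])
      split_ifs with hst
      · rw [le_antisymm hst hs, h]
      · rfl
  · rw [if_neg ht.not_ge]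
    refine (hg ht.le).congr_of_eventuallyEq ?_
    filter_upwards [Ioi_mem_nhds ht] with s hs
    rw [if_neg (not_le.2 hs)]

/-- `p.1` solves the delayed Duffing equation on `(-∞, b)`, with derivative `p.2`. -/
def DelayedDuffingBefore (T b : ℝ) (p : (ℝ → ℝ) × (ℝ → ℝ)) : Prop :=
  ∀ t < b, HasDerivAt p.1 (p.2 t) t ∧ HasDerivAt p.2 (-p.1 (t - T) - p.1 t ^ 3) t

lemma DelayedDuffingBefore.extend {T b : ℝ} (hT : 0 < T) {p : (ℝ → ℝ) × (ℝ → ℝ)}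
    (hp : DelayedDuffingBefore T b p) :
    ∃ q, DelayedDuffingBefore T (b + T / 2) q ∧
      ∀ t ≤ b - T / 2, q.1 t = p.1 t ∧ q.2 t = p.2 t := by
  obtain ⟨y, u⟩ := p
  set c := b - T / 2 with hc
  have hcb : c < b := by linarith
  have hg : Continuous fun t => y (min (t - T) c) := by
    refine continuous_iff_continuousAt.2 fun t => ?_
    have h1 : ContinuousAt y (min (t - T) c) :=
      (hp _ ((min_le_right _ _).trans_lt hcb)).1.continuousAt
    exact ContinuousAt.comp (f := fun t => min (t - T) c) h1 (by fun_prop)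
  obtain ⟨z, v, hz, hv, hzv⟩ := exists_forced_duffing hg (y c) (u c) c hT
  refine ⟨⟨fun t => if t ≤ c then y t else z t, fun t => if t ≤ c then u t else v t⟩,
    fun t ht => ⟨?_, ?_⟩, fun t ht => ⟨if_pos ht, if_pos ht⟩⟩
  · exact hasDerivAt_ite_le hz.symm hv.symm (fun h => (hp t (by linarith)).1)
      (fun h => (hzv t ⟨h, by linarith⟩).1)
  · have h1 := hasDerivAt_ite_le (f' := fun t => -y (t - T) - y t ^ 3)
      (g' := fun t => -y (min (t - T) c) - z t ^ 3) (t := t) hv.symm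
      (by simp only [hz, min_eq_left (by linarith : c - T ≤ c)])
      (fun h => (hp t (by linarith)).2) (fun h => (hzv t ⟨h, by linarith⟩).2)
    refine h1.congr_deriv ?_
    have h2 : t - T ≤ c := by linarith
    simp only [if_pos h2, min_eq_left h2]
    split_ifs <;> rfl

lemma DelayedDuffingBefore.exists_global {T b : ℝ} (hT : 0 < T) {p : (ℝ → ℝ) × (ℝ → ℝ)}
    (hp : DelayedDuffingBefore T b p) :
    ∃ y u : ℝ → ℝ,
      (∀ t, HasDerivAt y (u t) t ∧ HasDerivAt u (-y (t - T) - y t ^ 3) t) ∧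
      ∀ t ≤ b - T / 2, y t = p.1 t ∧ u t = p.2 t := by
  choose! e he he' using fun (b : ℝ) (p : (ℝ → ℝ) × (ℝ → ℝ)) (h : DelayedDuffingBefore T b p) =>
    h.extend hT
  let B : ℕ → ℝ := fun n => b + n * (T / 2)
  let q : ℕ → (ℝ → ℝ) × (ℝ → ℝ) := fun n => Nat.rec p (fun n r => e (B n) r) n
  have hBs : ∀ n, B (n + 1) = B n + T / 2 := fun n => by
    simp only [B]
    push_cast
    ring
  have hq : ∀ n, DelayedDuffingBefore T (B n) (q n) := fun n => by
    induction n with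
    | zero => simpa [B, q] using hp
    | succ n ih => rw [hBs]; exact he (B n) (q n) ih
  have hmono : Monotone B := monotone_nat_of_le_succ fun n => by rw [hBs]; linarith
  have hagree : ∀ n m, n ≤ m → ∀ t ≤ B n - T / 2, (q m).1 t = (q n).1 t ∧ (q m).2 t = (q n).2 t := by
    intro n m hnm t ht
    induction m, hnm using Nat.le_induction with
    | base => exact ⟨rfl, rfl⟩
    | succ m hnm ih =>
      have h1 := he' (B m) (q m) (hq m) t (ht.trans (by linarith [hmono hnm]))
      exact ⟨h1.1.trans ih.1, h1.2.trans ih.2⟩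
  have hN : ∀ t, ∃ n, t < B n - T / 2 := fun t => by
    obtain ⟨n, hn⟩ := exists_nat_gt ((t - b + T / 2) / (T / 2))
    rw [div_lt_iff₀ (by positivity)] at hn
    exact ⟨n, by simp only [B]; linarith⟩
  choose N hN using hN
  have hglue : ∀ n, ∀ t ≤ B n - T / 2, (q (N t)).1 t = (q n).1 t ∧ (q (N t)).2 t = (q n).2 t := by
    intro n t ht
    rcases le_total n (N t) with h | h
    · exact hagree _ _ h t ht
    · have := hagree _ _ h t (hN t).le
      exact ⟨this.1.symm, this.2.symm⟩
  refine ⟨fun t => (q (N t)).1 t, fun t => (q (N t)).2 t, fun t => ?_, fun t ht => ?_⟩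
  · have h1 := hq (N t) t ((hN t).trans (by linarith))
    have hev : ∀ᶠ s in 𝓝 t, s ≤ B (N t) - T / 2 := by
      filter_upwards [Iio_mem_nhds (hN t)] with s hs using le_of_lt hs
    refine ⟨h1.1.congr_of_eventuallyEq ?_, (h1.2.congr_of_eventuallyEq ?_).congr_deriv ?_⟩
    · filter_upwards [hev] with s hs using (hglue _ s hs).1
    · filter_upwards [hev] with s hs using (hglue _ s hs).2
    · beta_reduce
      rw [(hglue (N t) (t - T) (by linarith [hN t])).1]
  · exact hglue 0 t (by simpa [B] using ht)

lemma tendsto_iInf_iSup_of_tendsto {x y x' y' : ℝ → ℝ} {T : ℝ}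
    (h : Tendsto (fun t => y t - x t) atBot (𝓝 0))
    (h' : Tendsto (fun t => y' t - x' t) atBot (𝓝 0)) :
    Tendsto (fun t : ℝ => ⨅ θ : ℝ, ⨆ s ∈ Set.Icc (t - T) t,
      (|y s - x (s + θ)| + |y' s - x' (s + θ)|)) atBot (𝓝 0) := by
  have hnonneg : ∀ t θ : ℝ, 0 ≤ ⨆ s ∈ Set.Icc (t - T) t,
      (|y s - x (s + θ)| + |y' s - x' (s + θ)|) := fun t θ =>
    Real.iSup_nonneg fun s => Real.iSup_nonneg fun _ => by positivity
  have hsum : Tendsto (fun t => |y t - x t| + |y' t - x' t|) atBot (𝓝 0) := by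
    simpa using h.abs.add h'.abs
  rw [Metric.tendsto_nhds]
  intro ε hε
  obtain ⟨b, hb⟩ := eventually_atBot.1 (hsum.eventually (gt_mem_nhds (half_pos hε)))
  filter_upwards [eventually_le_atBot b] with t ht
  rw [Real.dist_eq, sub_zero, abs_of_nonneg (Real.iInf_nonneg (hnonneg t))]
  refine (ciInf_le ⟨0, by rintro _ ⟨θ, rfl⟩; exact hnonneg t θ⟩ 0).trans_lt ?_
  refine (Real.iSup_le (fun s => Real.iSup_le (fun hs => ?_) (half_pos hε).le)
    (half_pos hε).le).trans_lt (half_lt_self hε)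
  rw [add_zero]
  exact (hb s (hs.2.trans ht)).le

/-- for every `T > 0` and every sufficiently large even `n`, the lifted
nonconstant single-well Duffing solution of minimal period `2T/n` is an unstable periodic
orbit of the delayed Duffing equation: some solution, not a time shift of it, converges
to its orbit in backward time. -/
theorem delayedDuffing_even_instability (T : ℝ) (hT : 0 < T) :
    ∃ n₀ : ℕ, ∀ n : ℕ, Even n → n₀ ≤ n →
      ∀ x : ℝ → ℝ,
        Differentiable ℝ x → Differentiable ℝ (deriv x) →
        (∀ t : ℝ, deriv (deriv x) t + x t + (x t) ^ 3 = 0) →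
        (¬ ∃ c : ℝ, ∀ t : ℝ, x t = c) →
        IsLeast {q : ℝ | 0 < q ∧ ∀ t : ℝ, x (t + q) = x t} (2 * T / n) →
        ∃ y : ℝ → ℝ, Differentiable ℝ y ∧ Differentiable ℝ (deriv y) ∧
          (∀ t : ℝ, deriv (deriv y) t + y (t - T) + (y t) ^ 3 = 0) ∧
          (¬ ∃ θ : ℝ, ∀ t : ℝ, y t = x (t + θ)) ∧
          Tendsto
            (fun t : ℝ => ⨅ θ : ℝ, ⨆ s ∈ Set.Icc (t - T) t,
              (|y s - x (s + θ)| + |deriv y s - deriv x (s + θ)|))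
            atBot (nhds 0) := by
  refine ⟨1, fun n hn hn1 x hx hx' hode hnc hmin => ?_⟩
  have hxd : ∀ t, HasDerivAt x (deriv x t) t := fun t => (hx t).hasDerivAt
  have hvd : ∀ t, HasDerivAt (deriv x) (-x t - x t ^ 3) t := fun t => by
    have h1 := (hx' t).hasDerivAt
    rwa [show deriv (deriv x) t = -x t - x t ^ 3 by linarith [hode t]] at h1
  have hxT : ∀ t, x (t + T) = x t := by
    obtain ⟨m, rfl⟩ := hn
    have hm : (m : ℝ) ≠ 0 := by
      have : m ≠ 0 := by omega
      exact_mod_cast this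
    have hp : Function.Periodic x (m * (2 * T / (m + m : ℕ))) :=
      Function.Periodic.nat_mul hmin.1.2 m
    rwa [show (m : ℝ) * (2 * T / (m + m : ℕ)) = T by push_cast; field_simp; ring] at hp
  have hvT : ∀ t, deriv x (t + T) = deriv x t := fun t => by
    rw [← deriv_comp_add_const]
    simp only [hxT]
  obtain ⟨t₀, p, q, hpq, hlim, hlim', hne⟩ :=
    exists_unstable_solution_near_atBot hT hxd hvd hxT hvT hnc
  obtain ⟨y, u, hyu, hagree⟩ :=
    DelayedDuffingBefore.exists_global (b := t₀) (p := (p, q)) hT hpq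
  have hy' : deriv y = u := funext fun t => (hyu t).1.deriv
  have hev : ∀ᶠ t in atBot, y t = p t ∧ u t = q t :=
    (eventually_le_atBot (t₀ - T / 2)).mono hagree
  have hyx : Tendsto (fun t => y t - x t) atBot (𝓝 0) :=
    hlim.congr' (hev.mono fun t ht => by simp only [ht.1])
  have hyx' : Tendsto (fun t => u t - deriv x t) atBot (𝓝 0) :=
    hlim'.congr' (hev.mono fun t ht => by simp only [ht.2])
  refine ⟨y, fun t => (hyu t).1.differentiableAt, ?_, fun t => ?_, ?_, ?_⟩
  · rw [hy']
    exact fun t => (hyu t).2.differentiableAt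
  · rw [hy', (hyu t).2.deriv]
    ring
  · rintro ⟨θ, hθ⟩
    obtain ⟨t, ht, hne⟩ := hne (t₀ - T / 2)
    have hzero := eq_zero_of_periodic_of_tendsto_zero hT
      (fun t => by rw [hθ, hθ, hxT, add_right_comm, hxT]) hyx t
    rw [(hagree t ht.le).1] at hzero
    exact hne (sub_eq_zero.1 hzero)
  · rw [hy']
    exact tendsto_iInf_iSup_of_tendsto hyx hyx'
end

section
/- For every M > 0 there exists δ > 0 such that every twice differentiable solution x : ℝ → ℝ of the double-well Duffing equation x''(t) − x(t) + x(t)³ = 0 with strictly positive energy whose minimal period is less than δ satisfies sup_t |x(t)| > M. In particular, any sequence of positive-energy periodic solutions whose minimal periods tend to 0 has amplitudes tending to infinity. -/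
/-- The derivative of a periodic function is periodic. -/
theorem Function.Periodic.deriv_real {f : ℝ → ℝ} {p : ℝ} (hf : Function.Periodic f p) :
    Function.Periodic (deriv f) p := fun t => by
  rw [← deriv_comp_add_const f p t]
  exact congrArg (fun g => deriv g t) (funext hf)

/-- The absolute value of a continuous periodic function is bounded above. -/
theorem Function.Periodic.bddAbove_range_abs {f : ℝ → ℝ} {p : ℝ} (hf : Function.Periodic f p)
    (hp : p ≠ 0) (hc : Continuous f) : BddAbove (Set.range fun t => |f t|) :=
  (Function.Periodic.compact_of_continuous (f := fun t => |f t|)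
    (fun t => congrArg abs (hf t)) hp hc.abs).bddAbove

/-- If `f` has period `p > 0` and `|f''| ≤ C`, then `|f'| ≤ C * p`. -/
theorem Function.Periodic.abs_deriv_le {f : ℝ → ℝ} {p C : ℝ} (hf : Function.Periodic f p)
    (hp : 0 < p) (hd : Differentiable ℝ f) (hd' : Differentiable ℝ (deriv f))
    (hC : ∀ t, |deriv (deriv f) t| ≤ C) (t : ℝ) : |deriv f t| ≤ C * p := by
  obtain ⟨c, ⟨htc, hcp⟩, hc⟩ :=
    exists_deriv_eq_zero (lt_add_of_pos_right t hp) hd.continuous.continuousOn (hf t).symm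
  have h := convex_univ.norm_image_sub_le_of_norm_deriv_le (f := deriv f) (C := C)
    (fun s _ => hd' s) (fun s _ => hC s) (Set.mem_univ c) (Set.mem_univ t)
  rw [hc, sub_zero, Real.norm_eq_abs, Real.norm_eq_abs, abs_sub_comm,
    abs_of_pos (sub_pos.2 htc)] at h
  have hC0 : 0 ≤ C := (abs_nonneg _).trans (hC t)
  exact h.trans (mul_le_mul_of_nonneg_left (by linarith) hC0)

/-- positive-energy solutions of the double-well Duffing equation
with small minimal period have large amplitude. -/
theorem doubleWell_small_period_large_amplitude :
    ∀ M > (0:ℝ), ∃ δ > (0:ℝ), ∀ x : ℝ → ℝ,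
      Differentiable ℝ x → Differentiable ℝ (deriv x) →
      (∀ t : ℝ, deriv (deriv x) t - x t + (x t) ^ 3 = 0) →
      (∀ t : ℝ, 0 < (1/2) * (deriv x t) ^ 2 - (1/2) * (x t) ^ 2 + (1/4) * (x t) ^ 4) →
      ∀ p : ℝ, IsLeast {q : ℝ | 0 < q ∧ ∀ t : ℝ, x (t + q) = x t} p → p < δ →
        M < ⨆ t : ℝ, |x t| := by
  intro M hM
  refine ⟨1 / (1 + 3 * M ^ 2), by positivity, fun x hx hx' hode _ p hp hpδ => ?_⟩
  obtain ⟨⟨hp0, hper : Function.Periodic x p⟩, hmin⟩ := hp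
  by_contra! hsup
  have hxM : ∀ t, |x t| ≤ M := fun t =>
    (le_ciSup (hper.bddAbove_range_abs hp0.ne' hx.continuous) t).trans hsup
  set A := ⨆ t, |deriv x t|
  have hA : ∀ t, |deriv x t| ≤ A := fun t =>
    le_ciSup (hper.deriv_real.bddAbove_range_abs hp0.ne' hx'.continuous) t
  have hA0 : 0 ≤ A := (abs_nonneg _).trans (hA 0)
  have hx2 : deriv (deriv x) = fun t => x t - x t ^ 3 := by
    funext t
    linarith [hode t]
  have hx3 : ∀ t, HasDerivAt (deriv (deriv x)) ((1 - 3 * x t ^ 2) * deriv x t) t := fun t => by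
    rw [hx2]
    refine ((hx t).hasDerivAt.sub ((hx t).hasDerivAt.pow 3)).congr_deriv ?_
    norm_num
    ring
  set K := 1 + 3 * M ^ 2
  have hx3_le : ∀ t, |deriv (deriv (deriv x)) t| ≤ K * A := fun t => by
    rw [(hx3 t).deriv, abs_mul]
    have hsq : x t ^ 2 ≤ M ^ 2 := sq_le_sq' (abs_le.1 (hxM t)).1 (abs_le.1 (hxM t)).2
    have hK : |1 - 3 * x t ^ 2| ≤ K := abs_le.2 ⟨by nlinarith, by nlinarith [sq_nonneg (x t)]⟩
    exact mul_le_mul hK (hA t) (abs_nonneg _) (by positivity)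
  have hA_le : A ≤ K * A * p * p := ciSup_le <| hper.abs_deriv_le hp0 hx hx' <|
    hper.deriv_real.abs_deriv_le hp0 hx' (fun t => (hx3 t).differentiableAt) hx3_le
  have hK1 : 1 ≤ K := le_add_of_nonneg_right (by positivity)
  have hKp : p * K < 1 := (lt_div_iff₀ (by positivity)).1 hpδ
  have hKpp : K * p * p < 1 := by nlinarith
  have hA_zero : A = 0 := by nlinarith
  have hconst := is_const_of_deriv_eq_zero hx fun t =>
    abs_nonpos_iff.1 (hA_zero ▸ hA t)
  linarith [hmin (show p / 2 ∈ _ from ⟨half_pos hp0, fun t => hconst _ _⟩)]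
end
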